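/- arXiv:2309.12549 — 3 statements merged into one kernel-verified Lean document; each statement's English description precedes it below -/
import Mathlib

section
/- Let s and t be integers with 2 ≤ s < t, and with s ≠ 4 if t is even. Let D = {±1, ±2, …, ±(s−1)/2} (as residues modulo t) if s is odd, and D = {−1} ∪ {±2, ±3, …, ±(s/2)} if s is even. Then Circ(t; D) admits a C_t-factorization. -/
/-- The set of residues {±lo, ±(lo+1), …, ±hi} in Z_t. -/
def pmSet (t lo hi : ℕ) : Finset (ZMod t) :=
  ((Finset.Icc lo hi).image fun j : ℕ => (j : ZMod t)) ∪
  ((Finset.Icc lo hi).image fun j : ℕ => -(j : ZMod t))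

/-- A C_t-factorization of the directed circulant Circ(t; D): a family of |D|
permutations of Z_t, each a single directed cycle of length t, such that
σ(i) − i ∈ D always, and for each vertex i and each difference d ∈ D there is
exactly one member σ with σ(i) = i + d. -/
def CirculantHamFactorization (t : ℕ) [NeZero t] (D : Finset (ZMod t)) : Prop :=
  ∃ σ : Fin D.card → Equiv.Perm (ZMod t),
    (∀ j, (σ j).cycleType = ({t} : Multiset ℕ)) ∧
    (∀ j i, σ j i - i ∈ D) ∧
    (∀ i : ZMod t, ∀ d ∈ D, ∃! j, σ j i = i + d)

section

open Equiv SimpleGraph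

/-- `G` is a Hamilton cycle, traversed by the cyclic permutation `σ`. -/
structure TraversedBy {V : Type*} [Fintype V] [DecidableEq V] (G : SimpleGraph V)
    (σ : Perm V) : Prop where
  isCycle : σ.IsCycle
  support : σ.support = Finset.univ
  ne : ∀ v, σ v ≠ σ⁻¹ v
  adj : ∀ v w, G.Adj v w ↔ w = σ v ∨ w = σ⁻¹ v

lemma TraversedBy.inv {V : Type*} [Fintype V] [DecidableEq V] {G : SimpleGraph V}
    {σ : Perm V} (h : TraversedBy G σ) : TraversedBy G σ⁻¹ where
  isCycle := h.isCycle.inv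
  support := by rw [Perm.support_inv, h.support]
  ne v := by simpa using (h.ne v).symm
  adj v w := by rw [h.adj, inv_inv, or_comm]

/-- A connected graph in which every vertex has exactly two neighbours is a Hamilton cycle. -/
lemma exists_traversedBy {V : Type*} [Fintype V] [DecidableEq V] [Nonempty V]
    (G : SimpleGraph V)
    (hreg : ∀ v, ∃ a b, a ≠ b ∧ ∀ w, G.Adj v w ↔ w = a ∨ w = b)
    (hconn : ∀ v w, G.Reachable v w) : ∃ σ, TraversedBy G σ := by
  classical
  have hset : ∀ v, (G.neighborSet v).ncard = 2 := by
    intro v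
    obtain ⟨a, b, hab, h⟩ := hreg v
    have : G.neighborSet v = {a, b} := by
      ext w; simp [h w]
    rw [this, Set.ncard_pair hab]
  have hcyc : G.IsCycles := fun v _ => hset v
  obtain ⟨v⟩ := ‹Nonempty V›
  have hne : (G.neighborSet v).Nonempty := by
    obtain ⟨a, b, hab, h⟩ := hreg v
    exact ⟨a, (h a).2 (Or.inl rfl)⟩
  obtain ⟨p, hp, hverts⟩ := hcyc.exists_cycle_toSubgraph_verts_eq_connectedComponentSupp
    (c := G.connectedComponentMk v) (v := v) (by simp) hne
  have hmem : ∀ w, w ∈ p.support.tail := by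
    intro w
    have : w ∈ p.toSubgraph.verts := by
      rw [hverts]; simpa using hconn w v
    rw [Walk.mem_verts_toSubgraph] at this
    rcases p.mem_support_iff.1 this with h | h
    · rw [h]; exact Walk.end_mem_tail_support hp.not_nil
    · exact h
  have hnd : p.support.tail.Nodup := hp.support_nodup
  have hlen : p.support.tail.length = p.length := by simp
  have h3 : 3 ≤ p.length := hp.three_le_length
  have hget : ∀ i (hi : i < p.support.tail.length), p.support.tail[i] = p.getVert (i + 1) := by
    intro i hi
    rw [List.getElem_tail, Walk.support_getElem_eq_getVert]
  set σ := p.support.tail.formPerm with hσ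
  have hadj : ∀ w, G.Adj w (σ w) := by
    intro w
    obtain ⟨i, hi, rfl⟩ := List.getElem_of_mem (hmem w)
    rw [hσ, List.formPerm_apply_getElem _ hnd, hget, hget]
    rw [hlen] at hi
    simp only [hlen]
    rcases Nat.lt_or_ge (i + 1) p.length with h | h
    · rw [Nat.mod_eq_of_lt h]
      exact p.adj_getVert_succ h
    · have : i + 1 = p.length := by omega
      rw [this, Nat.mod_self, Walk.getVert_length]
      simpa using p.adj_getVert_succ (i := 0) (by omega)
  have hcycle : σ.IsCycle := List.isCycle_formPerm hnd (by omega)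
  have hsupp : σ.support = Finset.univ := by
    ext w
    simp only [Perm.mem_support, Finset.mem_univ, iff_true]
    exact (hadj w).ne'
  have hcard : 3 ≤ Fintype.card V := by
    have := hnd.length_le_card
    omega
  have hinv : ∀ w, σ (σ⁻¹ w) = w := fun w => (Perm.inv_eq_iff_eq.1 rfl).symm
  have hsq : ∀ w, σ w ≠ σ⁻¹ w := by
    intro w hw
    have h2 : (σ ^ 2) w = w := by
      rw [pow_two, Perm.mul_apply, hw, hinv]
    have : σ ^ 2 = 1 := hcycle.pow_eq_one_iff.2 ⟨w, (hadj w).ne', h2⟩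
    have := Nat.le_of_dvd two_pos (orderOf_dvd_of_pow_eq_one this)
    rw [hcycle.orderOf, hsupp, Finset.card_univ] at this
    omega
  refine ⟨σ, hcycle, hsupp, hsq, fun w z => ?_⟩
  obtain ⟨a, b, hab, h⟩ := hreg w
  have h1 := (h _).1 (hadj w)
  have h2' := hadj (σ⁻¹ w)
  rw [hinv] at h2'
  have h2 := (h _).1 h2'.symm
  have h3 := hsq w
  rw [h]
  grind

/-- Replacing the edges `y — σ y` and `z — σ z` of a Hamilton cycle by `y — z` and
`σ y — σ z` gives a Hamilton cycle again. -/
lemma TraversedBy.exists_switch {V : Type*} [Fintype V] [DecidableEq V] [Nonempty V]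
    {G G' : SimpleGraph V} {σ : Perm V} (h : TraversedBy G σ) {y z : V}
    (hyz : y ≠ z) (hadj : ¬ G.Adj y z) (hadj' : ¬ G.Adj (σ y) (σ z))
    (hG' : ∀ v w, G'.Adj v w ↔
      (G.Adj v w ∧ s(v, w) ≠ s(y, σ y) ∧ s(v, w) ≠ s(z, σ z)) ∨
        s(v, w) = s(y, z) ∨ s(v, w) = s(σ y, σ z)) :
    ∃ τ, TraversedBy G' τ := by
  have hinv : ∀ v w, σ⁻¹ v = w ↔ v = σ w := fun v w => Perm.inv_eq_iff_eq
  have hfix : ∀ v, σ v ≠ v := by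
    intro v
    have := Finset.mem_univ v
    rwa [← h.support, Perm.mem_support] at this
  have h2 : ∀ v, σ (σ v) ≠ v := fun v hv => h.ne v (by rw [eq_comm, hinv, hv])
  rw [h.adj, eq_comm (b := σ⁻¹ y), hinv] at hadj
  rw [h.adj, eq_comm (b := σ⁻¹ (σ y)), hinv] at hadj'
  push Not at hadj hadj'
  have hne1 : y ≠ σ z := hadj.2
  have hne2 : z ≠ σ y := hadj.1
  have hne3 : σ y ≠ σ (σ z) := fun hh => hne1 (σ.injective hh)
  have hne4 : σ z ≠ σ (σ y) := fun hh => hne2 (σ.injective hh)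
  have hne5 : σ y ≠ σ z := fun hh => hyz (σ.injective hh)
  have key : ∀ v w, G'.Adj v w ↔
      ((w = σ v ∧ v ≠ y ∧ v ≠ z) ∨ (v = σ w ∧ w ≠ y ∧ w ≠ z)) ∨
      ((v = y ∧ w = z ∨ v = z ∧ w = y) ∨ (v = σ y ∧ w = σ z ∨ v = σ z ∧ w = σ y)) := by
    intro v w
    rw [hG', h.adj, eq_comm (b := σ⁻¹ v), hinv]
    simp only [ne_eq, Sym2.eq_iff]
    have := h2 y
    have := h2 z
    grind
  refine exists_traversedBy G' (fun v => ?_) ?_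
  · by_cases hv1 : v = y
    · subst hv1
      refine ⟨σ⁻¹ v, z, ?_, fun w => ?_⟩
      · intro hh; rw [hinv] at hh; exact hne1 hh
      · rw [key, eq_comm (b := σ⁻¹ v), hinv]
        have := h2 v; have := hfix v
        grind
    by_cases hv2 : v = z
    · subst hv2
      refine ⟨σ⁻¹ v, y, ?_, fun w => ?_⟩
      · intro hh; rw [hinv] at hh; exact hne2 hh
      · rw [key, eq_comm (b := σ⁻¹ v), hinv]
        have := h2 v; have := hfix v
        grind
    by_cases hv3 : v = σ y
    · refine ⟨σ v, σ z, ?_, fun w => ?_⟩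
      · rw [hv3]; exact hne4.symm
      · rw [key]
        have := σ.injective.eq_iff (a := y) (b := w)
        grind
    by_cases hv4 : v = σ z
    · refine ⟨σ v, σ y, ?_, fun w => ?_⟩
      · rw [hv4]; exact hne3.symm
      · rw [key]
        have := σ.injective.eq_iff (a := z) (b := w)
        grind
    refine ⟨σ v, σ⁻¹ v, h.ne v, fun w => ?_⟩
    rw [key, eq_comm (b := σ⁻¹ v), hinv]
    grind
  · have hcl : ∀ C : Set V, y ∈ C → (∀ v ∈ C, σ v ∈ C) → ∀ v, v ∈ C := by
      intro C hy hC v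
      obtain ⟨n, hn⟩ := h.isCycle.exists_pow_eq (hfix y) (hfix v)
      have : ∀ n : ℕ, (σ ^ n) y ∈ C := by
        intro n
        induction n with
        | zero => simpa
        | succ n ih => rw [pow_succ', Perm.mul_apply]; exact hC _ ih
      exact hn ▸ this n
    have hr1 : G'.Reachable y z := Adj.reachable ((key _ _).2 (by tauto))
    have hr2 : G'.Reachable (σ y) (σ z) := Adj.reachable ((key _ _).2 (by tauto))
    have hstep : ∀ v, v ≠ y → v ≠ z → G'.Reachable v (σ v) :=
      fun v h1 h2 => Adj.reachable ((key _ _).2 (by tauto))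
    suffices hy : ∀ v, G'.Reachable y v from fun v w => (hy v).symm.trans (hy w)
    have hσy : G'.Reachable y (σ y) := by
      by_contra hcon
      have : ∀ v, v ∈ {v | G'.Reachable (σ y) v} := by
        have : ∀ v, v ∈ {v | G'.Reachable (σ y) (σ v)} := by
          refine hcl _ (by simp) fun v hv => ?_
          refine Reachable.trans hv (hstep _ ?_ ?_)
          · rintro rfl
            exact hcon (Reachable.symm hv)
          · rintro rfl
            exact hcon (hr1.trans (Reachable.symm hv))
        intro v
        simpa using this (σ⁻¹ v)
      exact hcon (Reachable.symm (this y))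
    refine hcl {v | G'.Reachable y v} (Reachable.refl _) fun v hv => ?_
    by_cases h1 : v = y
    · rw [h1]; exact hσy
    by_cases h2 : v = z
    · rw [h2]; exact hσy.trans hr2
    exact Reachable.trans hv (hstep v h1 h2)

/-- On `ZMod t`, the graph of all edges `u — u + q`, except that for every `x ∈ S` the edges
`x — x + q` and `x + p — x + p + q` are replaced by `x — x + p` and `x + q — x + q + p`. -/
def switchGraph {t : ℕ} (q p : ZMod t) (S : Set (ZMod t)) : SimpleGraph (ZMod t) :=
  SimpleGraph.fromRel fun u w =>
    (w = u + q ∧ u ∉ S ∧ u - p ∉ S) ∨ (w = u + p ∧ (u ∈ S ∨ u - q ∈ S))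

section switchGraph

variable {t : ℕ} {q p : ZMod t} {S : Set (ZMod t)}

lemma switchGraph_adj {u w : ZMod t} : (switchGraph q p S).Adj u w ↔ u ≠ w ∧
    (((w = u + q ∧ u ∉ S ∧ u - p ∉ S) ∨ (w = u + p ∧ (u ∈ S ∨ u - q ∈ S))) ∨
      ((u = w + q ∧ w ∉ S ∧ w - p ∉ S) ∨ (u = w + p ∧ (w ∈ S ∨ w - q ∈ S)))) :=
  Iff.rfl

lemma switchGraph_reachable_left {u : ZMod t} (h : u ∉ S) (h' : u - p ∉ S) :
    (switchGraph q p S).Reachable u (u + q) := by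
  by_cases hu : u = u + q
  · rw [← hu]
  · exact Adj.reachable (switchGraph_adj.2 ⟨hu, Or.inl (Or.inl ⟨rfl, h, h'⟩)⟩)

lemma switchGraph_reachable_right {u : ZMod t} (h : u ∈ S ∨ u - q ∈ S) :
    (switchGraph q p S).Reachable u (u + p) := by
  by_cases hu : u = u + p
  · rw [← hu]
  · exact Adj.reachable (switchGraph_adj.2 ⟨hu, Or.inl (Or.inr ⟨rfl, h⟩)⟩)

lemma switchGraph_adj_left (hq : 2 * q ≠ 0) (hpq : p ≠ q) (hpq' : p + q ≠ 0) {u : ZMod t} :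
    (switchGraph q p S).Adj u (u + q) ↔ u ∉ S ∧ u - p ∉ S := by
  rw [switchGraph_adj]
  grind

lemma switchGraph_adj_right (hp : 2 * p ≠ 0) (hpq : p ≠ q) (hpq' : p + q ≠ 0) {u : ZMod t} :
    (switchGraph q p S).Adj u (u + p) ↔ u ∈ S ∨ u - q ∈ S := by
  rw [switchGraph_adj]
  grind

lemma switchGraph_adj_sub {u w : ZMod t} (h : (switchGraph q p S).Adj u w) :
    w = u + q ∨ w = u - q ∨ w = u + p ∨ w = u - p := by
  rw [switchGraph_adj] at h
  grind

lemma switchGraph_neighbors (hp : 2 * p ≠ 0) (hq : 2 * q ≠ 0) (hpq : p ≠ q) (hpq' : p + q ≠ 0)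
    (hS : ∀ x ∈ S, x + p ∉ S ∧ x + q ∉ S) (v : ZMod t) :
    ∃ a b, a ≠ b ∧ ∀ w, (switchGraph q p S).Adj v w ↔ w = a ∨ w = b := by
  have key : ∀ w, (switchGraph q p S).Adj v w ↔
      (w = v + q ∧ v ∉ S ∧ v - p ∉ S) ∨ (w = v + p ∧ (v ∈ S ∨ v - q ∈ S)) ∨
      (w = v - q ∧ v - q ∉ S ∧ v - q - p ∉ S) ∨
      (w = v - p ∧ (v - p ∈ S ∨ v - q - p ∈ S)) := by
    intro w
    rw [switchGraph_adj]
    constructor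
    · rintro ⟨-, (⟨rfl, h⟩ | ⟨rfl, h⟩) | ⟨h', h⟩ | ⟨h', h⟩⟩
      · exact Or.inl ⟨rfl, h⟩
      · exact Or.inr (Or.inl ⟨rfl, h⟩)
      · obtain rfl : w = v - q := by rw [h']; ring
        exact Or.inr (Or.inr (Or.inl ⟨rfl, h⟩))
      · obtain rfl : w = v - p := by rw [h']; ring
        rw [sub_right_comm] at h
        exact Or.inr (Or.inr (Or.inr ⟨rfl, h⟩))
    · have : v - q - p = v - p - q := by ring
      rintro (⟨rfl, h⟩ | ⟨rfl, h⟩ | ⟨rfl, h⟩ | ⟨rfl, h⟩)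
      · refine ⟨by grind, by tauto⟩
      · refine ⟨by grind, by tauto⟩
      · refine ⟨by grind, Or.inr (Or.inl ⟨by ring, h⟩)⟩
      · refine ⟨by grind, Or.inr (Or.inr ⟨by ring, ?_⟩)⟩
        rwa [← this]
  simp only [key]
  have h1 := hS v
  have h2 := hS (v - p)
  have h3 := hS (v - q)
  have h4 := hS (v - q - p)
  have e1 : v - q - p + p = v - q := by ring
  have e2 : v - q - p + q = v - p := by ring
  simp only [sub_add_cancel, e1, e2] at h2 h3 h4
  have d1 : v + q ≠ v - q := by grind
  have d2 : v + p ≠ v - p := by grind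
  have d3 : v + q ≠ v + p := by grind
  have d4 : v + q ≠ v - p := by grind
  have d5 : v - q ≠ v + p := by grind
  have d6 : v - q ≠ v - p := by grind
  by_cases A : v ∈ S <;> by_cases B : v - p ∈ S <;> by_cases C : v - q ∈ S <;>
    by_cases E : v - q - p ∈ S <;> simp only [A, B, C, E, not_true_eq_false, not_false_eq_true,
      and_true, and_false, or_true, or_false, false_or, true_and, false_and,
      forall_true_left, imp_false] at h1 h2 h3 h4 ⊢
  all_goals first
    | exact absurd h1 id
    | exact ⟨_, _, d1, fun w => Iff.rfl⟩
    | exact ⟨_, _, d2, fun w => Iff.rfl⟩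
    | exact ⟨_, _, d3, fun w => Iff.rfl⟩
    | exact ⟨_, _, d4, fun w => Iff.rfl⟩
    | exact ⟨_, _, d5, fun w => Iff.rfl⟩
    | exact ⟨_, _, d5.symm, fun w => Iff.rfl⟩
    | exact ⟨_, _, d6, fun w => Iff.rfl⟩

/-- Walking along the edges `u — u + q` from `u + q`, where all edges of this kind in the class
of `v` modulo `q` are present except possibly those at `u` and `v`. -/
lemma reachable_arc {G : SimpleGraph (ZMod t)} {u v : ZMod t}
    (hu : ∃ i : ℕ, v = u + (i + 1) * q)
    (hG : ∀ i : ℕ, u + (i + 1) * q ≠ u → u + (i + 1) * q ≠ v →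
      G.Reachable (u + (i + 1) * q) (u + (i + 1) * q + q)) :
    G.Reachable (u + q) v := by
  classical
  set n := Nat.find hu with hn
  have hv : v = u + (n + 1) * q := Nat.find_spec hu
  have hmin : ∀ m < n, v ≠ u + (m + 1) * q := fun m hm => Nat.find_min hu hm
  have : ∀ m ≤ n, G.Reachable (u + q) (u + (m + 1) * q) := by
    intro m
    induction m with
    | zero => intro _; simp
    | succ m ih =>
      intro hm
      refine (ih (by omega)).trans ?_
      convert hG m ?_ (hmin m (by omega)).symm using 1
      · push_cast; ring
      · intro hcon
        refine hmin (n - (m + 1)) (by omega) ?_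
        rw [hv, Nat.cast_sub (by omega)]
        push_cast
        linear_combination hcon
  rw [hv]
  exact this n le_rfl

lemma reachable_of_class {G : SimpleGraph (ZMod t)} {u v y : ZMod t}
    (hy : ∃ i : ℕ, v = y + i * q)
    (hG : ∀ i : ℕ, y + i * q ≠ u → y + i * q ≠ v →
      G.Reachable (y + i * q) (y + i * q + q)) :
    G.Reachable y u ∨ G.Reachable y v := by
  by_contra! hcon
  obtain ⟨i, hi⟩ := hy
  have : ∀ m : ℕ, G.Reachable y (y + m * q) := by
    intro m
    induction m with
    | zero => simp
    | succ m ih =>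
      refine ih.trans ?_
      convert hG m ?_ ?_ using 1
      · push_cast; ring
      · intro h; rw [h] at ih; exact hcon.1 ih
      · intro h; rw [h] at ih; exact hcon.2 ih
  exact hcon.2 (hi ▸ this i)

end switchGraph


/-- If the elements of `S` lie in consecutive classes modulo `q`, one for each of `L` classes,
where `L` is odd and misses at most one class, then the switched graph is connected. -/
lemma switchGraph_reachable_of_rows {t h L : ℕ} {q p : ZMod t} (ρ : ZMod t → ZMod h)
    (hq : ∀ y, ρ (y + q) = ρ y) (hp : ∀ y, ρ (y + p) = ρ y + 1)
    (hclass : ∀ y v, ρ y = ρ v → ∃ i : ℕ, v = y + i * q)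
    (x : ℕ → ZMod t) (hx : ∀ r < L, ρ (x r) = r) (hL : Odd L) (hLh : L = h ∨ L + 1 = h)
    {S : Set (ZMod t)} (hS : ∀ y, y ∈ S ↔ ∃ r < L, y = x r) (v w : ZMod t) :
    (switchGraph q p S).Reachable v w := by
  set G := switchGraph q p S with hG
  have hL0 : 0 < L := hL.pos
  have : NeZero h := ⟨by omega⟩
  have hinj : ∀ a < h, ∀ b < h, (a : ZMod h) = b → a = b := by
    intro a ha b hb hab
    rwa [ZMod.natCast_eq_natCast_iff', Nat.mod_eq_of_lt ha, Nat.mod_eq_of_lt hb] at hab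
  have hxS : ∀ r < L, x r ∈ S := fun r hr => (hS _).2 ⟨r, hr, rfl⟩
  have hlink : ∀ r < L, G.Reachable (x r) (x r + p) := fun r hr =>
    switchGraph_reachable_right (Or.inl (hxS r hr))
  have hlink' : ∀ r < L, G.Reachable (x r + q) (x r + p + q) := by
    intro r hr
    rw [add_right_comm]
    refine switchGraph_reachable_right (Or.inr ?_)
    rw [add_sub_cancel_right]
    exact hxS r hr
  have hmul : ∀ (y : ZMod t) (i : ℕ), ρ (y + i * q) = ρ y := by
    intro y i
    induction i with
    | zero => simp
    | succ i ih => rw [← ih, ← hq (y + i * q)]; congr 1; push_cast; ring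
  have hmul' : ∀ (y : ZMod t) (i : ℕ), ρ (y + (i + 1) * q) = ρ y := by
    intro y i
    exact_mod_cast hmul y (i + 1)
  have hclass' : ∀ y v, ρ y = ρ v → ∃ i : ℕ, v = y + (i + 1) * q := by
    intro y v h
    obtain ⟨i, hi⟩ := hclass (y + q) v (by rw [hq, h])
    exact ⟨i, by linear_combination hi⟩
  have hedge : ∀ r < L, ∀ r' < L, (r' : ZMod h) = r + 1 → ∀ y, ρ y = r + 1 →
      y ≠ x r' → y ≠ x r + p → G.Reachable y (y + q) := by
    intro r hr r' hr' hrr y hy h1 h2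
    refine switchGraph_reachable_left ?_ ?_
    · rw [hS]
      rintro ⟨a, ha, rfl⟩
      rw [hx a ha, ← hrr] at hy
      rw [hinj a (by omega) r' (by omega) hy] at h1
      exact h1 rfl
    · rw [hS]
      rintro ⟨a, ha, hya⟩
      obtain rfl : y = x a + p := by rw [← hya]; ring
      rw [hp, hx a ha] at hy
      rw [hinj a (by omega) r (by omega) (add_right_cancel hy)] at h2
      exact h2 rfl
  have hρp : ∀ r < L, ρ (x r + p) = r + 1 := fun r hr => by rw [hp, hx r hr]
  have hstep : ∀ r < L, ∀ r' < L, (r' : ZMod h) = r + 1 →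
      G.Reachable (x r) (x r' + q) ∧ G.Reachable (x r + q) (x r') ∧
      ∀ y, ρ y = r' → G.Reachable y (x r) ∨ G.Reachable y (x r') := by
    intro r hr r' hr' hrr
    have hu : ρ (x r + p) = ρ (x r') := by rw [hρp r hr, hx r' hr', hrr]
    refine ⟨?_, ?_, fun y hy => ?_⟩
    · refine (hlink r hr).trans (Reachable.symm (reachable_arc (hclass' _ _ hu.symm) ?_))
      intro i h1 h2
      exact hedge r hr r' hr' hrr _ (by rw [hmul', hx r' hr', hrr]) h1 h2
    · refine (hlink' r hr).trans (reachable_arc (hclass' _ _ hu) ?_)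
      intro i h1 h2
      exact hedge r hr r' hr' hrr _ (by rw [hmul', hρp r hr]) h2 h1
    · refine (reachable_of_class (u := x r + p) (v := x r')
        (hclass _ _ (by rw [hy, hx r' hr'])) ?_).imp_left fun hh => hh.trans (hlink r hr).symm
      intro i h1 h2
      exact hedge r hr r' hr' hrr _ (by rw [hmul, hy, hrr]) h2 h1
  have hmain : ∀ r < L,
      (Even r → G.Reachable (x 0) (x r) ∧ G.Reachable (x 0 + q) (x r + q)) ∧
      (Odd r → G.Reachable (x 0) (x r + q) ∧ G.Reachable (x 0 + q) (x r)) := by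
    intro r
    induction r with
    | zero => intro _; simp
    | succ r ih =>
      intro hr
      obtain ⟨h1, h2, -⟩ := hstep r (by omega) (r + 1) hr (by push_cast; rfl)
      obtain ⟨h3, h4⟩ := ih (by omega)
      constructor
      · intro he
        obtain ⟨h5, h6⟩ := h4 (by grind)
        exact ⟨h5.trans h2, h6.trans h1⟩
      · intro he
        obtain ⟨h5, h6⟩ := h3 (by grind)
        exact ⟨h5.trans h1, h6.trans h2⟩
  have hrow0 : L + 1 = h → ∀ y, ρ y = 0 → y ≠ x 0 → G.Reachable y (y + q) := by
    intro hh y hy hy0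
    refine switchGraph_reachable_left ?_ ?_
    · rw [hS]
      rintro ⟨a, ha, rfl⟩
      rw [hx a ha] at hy
      exact hy0 (by rw [hinj a (by omega) 0 (by omega) (by simpa using hy)])
    · rw [hS]
      rintro ⟨a, ha, hya⟩
      obtain rfl : y = x a + p := by rw [← hya]; ring
      rw [hρp a ha] at hy
      have := hinj (a + 1) (by omega) 0 (by omega) (by push_cast; exact hy)
      omega
  have hrowL : L + 1 = h → ∀ y, ρ y = L → y ≠ x (L - 1) + p → G.Reachable y (y + q) := by
    intro hh y hy hy0
    refine switchGraph_reachable_left ?_ ?_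
    · rw [hS]
      rintro ⟨a, ha, rfl⟩
      rw [hx a ha] at hy
      have := hinj a (by omega) L (by omega) hy
      omega
    · rw [hS]
      rintro ⟨a, ha, hya⟩
      obtain rfl : y = x a + p := by rw [← hya]; ring
      rw [hρp a ha] at hy
      have := hinj (a + 1) (by omega) L (by omega) (by push_cast; exact hy)
      exact hy0 (by rw [← this, Nat.add_sub_cancel])
  have hx0 : ρ (x 0) = 0 := by simpa using hx 0 hL0
  have hcast : L = h → ((0 : ℕ) : ZMod h) = ((L - 1 : ℕ) : ZMod h) + 1 := by
    intro hh
    have : ((L - 1 + 1 : ℕ) : ZMod h) = 0 := by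
      rw [Nat.sub_add_cancel hL0, hh, ZMod.natCast_self]
    push_cast at this ⊢
    exact this.symm
  have hloop : G.Reachable (x 0) (x 0 + q) := by
    rcases hLh with hh | hh
    · obtain ⟨h1, -, -⟩ := hstep (L - 1) (by omega) 0 hL0 (hcast hh)
      exact (((hmain (L - 1) (by omega)).1 (by grind)).1).trans h1
    · refine Reachable.symm (reachable_arc (hclass' _ _ rfl) ?_)
      intro i h1 _
      exact hrow0 hh _ (by rw [hmul', hx0]) h1
  have hall : ∀ r < L, G.Reachable (x r) (x 0) := by
    intro r hr
    rcases Nat.even_or_odd r with he | he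
    · exact ((hmain r hr).1 he).1.symm
    · exact ((hmain r hr).2 he).2.symm.trans hloop.symm
  suffices hy : ∀ y, G.Reachable y (x 0) from (hy v).trans (hy w).symm
  intro y
  have hval : ρ y = ((ρ y).val : ZMod h) := (ZMod.natCast_zmod_val _).symm
  have hlt := ZMod.val_lt (ρ y)
  set c := (ρ y).val
  rcases Nat.lt_or_ge c L with hc | hc
  · rcases Nat.eq_zero_or_pos c with h0 | h0
    · rw [h0] at hval
      rcases hLh with hh | hh
      · rcases (hstep (L - 1) (by omega) 0 hL0 (hcast hh)).2.2 y hval with h1 | h1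
        · exact h1.trans (hall _ (by omega))
        · exact h1
      · refine (or_self_iff.1 (reachable_of_class (u := x 0) (v := x 0)
          (hclass _ _ (by rw [hval, hx0]; simp)) ?_))
        intro i h1 _
        exact hrow0 hh _ (by rw [hmul, hval]; simp) h1
    · have hcc : (c : ZMod h) = ((c - 1 : ℕ) : ZMod h) + 1 := by
        rw [Nat.cast_sub h0]; simp
      rcases (hstep (c - 1) (by omega) c hc hcc).2.2 y hval with h1 | h1
      · exact h1.trans (hall _ (by omega))
      · exact h1.trans (hall _ hc)
  · have hh : L + 1 = h := by omega
    obtain rfl : c = L := by omega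
    have hLr : ρ (x (c - 1) + p) = c := by
      rw [hρp _ (by omega), Nat.cast_sub hL0]; simp
    refine (or_self_iff.1 (reachable_of_class (u := x (c - 1) + p) (v := x (c - 1) + p)
      (hclass _ _ (by rw [hval, hLr])) ?_)).trans
        ((hlink _ (by omega)).symm.trans (hall _ (by omega)))
    intro i h1 _
    exact hrowL hh _ (by rw [hmul, hval]) h1

lemma switchGraph_reachable_of_ringHom {t h L : ℕ} {q p : ZMod t} (ρ : ZMod t →+* ZMod h)
    (hq : ρ q = 0) (hp : ρ p = 1) (hker : ∀ y, ρ y = 0 → ∃ i : ℕ, y = i * q)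
    (x : ℕ → ZMod t) (c : ZMod h) (hx : ∀ r < L, ρ (x r) = c + r) (hL : Odd L)
    (hLh : L = h ∨ L + 1 = h) {S : Set (ZMod t)} (hS : ∀ y, y ∈ S ↔ ∃ r < L, y = x r)
    (v w : ZMod t) : (switchGraph q p S).Reachable v w := by
  refine switchGraph_reachable_of_rows (fun y => ρ y - c) (fun y => ?_) (fun y => ?_)
    (fun y v hyv => ?_) x (fun r hr => ?_) hL hLh hS v w
  · rw [map_add, hq, add_zero]
  · rw [map_add, hp]; ring
  · obtain ⟨i, hi⟩ := hker (v - y) (by rw [map_sub, sub_left_injective hyv, sub_self])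
    exact ⟨i, by linear_combination hi⟩
  · rw [hx r hr, add_sub_cancel_left]

lemma reachable_map_of_adj {V W : Type*} {G : SimpleGraph V} {G' : SimpleGraph W} (φ : V → W)
    (hφ : ∀ u w, G.Adj u w → G'.Reachable (φ u) (φ w)) {u w : V} (h : G.Reachable u w) :
    G'.Reachable (φ u) (φ w) := by
  obtain ⟨p⟩ := h
  induction p with
  | nil => exact Reachable.refl _
  | cons h _ ih => exact (hφ _ _ h).trans ih

/-- Two further switches next to a switched position `x` reroute two edges `u — u + p` and keep
the graph connected. -/
lemma switchGraph_reachable_insert {t : ℕ} {p q x : ZMod t} {S : Set (ZMod t)}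
    (hp : p ≠ 0) (hq : 2 * q ≠ 0) (h1 : p ≠ q) (h2 : p + q ≠ 0) (h3 : p + 2 * q ≠ 0)
    (h4 : p ≠ 2 * q) (hx : x ∈ S) (n1 : x + p ∉ S) (n2 : x + p - q ∉ S) (n3 : x + 2 * p ∉ S)
    (n4 : x + p + q ∉ S) (n5 : x + q ∉ S) (n6 : x + 2 * p + q ∉ S) (n7 : x - q ∉ S)
    (n8 : x + 2 * p - q ∉ S) (hS : ∀ v w, (switchGraph p q S).Reachable v w) (v w : ZMod t) :
    (switchGraph p q (insert (x + p - q) (insert (x + 2 * p) S))).Reachable v w := by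
  classical
  obtain ⟨S', hS'⟩ : ∃ S', S' = insert (x + p - q) (insert (x + 2 * p) S) := ⟨_, rfl⟩
  rw [← hS']
  have mem : ∀ u, u ∈ S' ↔ u = x + p - q ∨ u = x + 2 * p ∨ u ∈ S := by
    intro u; simp [hS']
  clear hS'
  have hq0 : q ≠ 0 := by rintro rfl; simp at hq
  obtain ⟨T, memT⟩ : ∃ T : Set (ZMod t), ∀ u, u ∈ T ↔
      u = x + p ∨ u = x + 2 * p ∨ u = x + p + q ∨ u = x + 2 * p + q :=
    ⟨{x + p, x + 2 * p, x + p + q, x + 2 * p + q}, fun u => by simp⟩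
  have m1 : x + p ∉ S' := by rw [mem]; grind
  have m2 : x + p + q ∉ S' := by rw [mem]; grind
  have yT : x + p - q ∉ T := by rw [memT]; grind
  have yT' : x + 2 * p - q ∉ T := by rw [memT]; grind
  have f1 : ∀ u, u - q ∉ S → u ≠ x + p → u ≠ x + 2 * p + q → u - q ∉ S' := by
    intro u; rw [mem]; grind
  have f2 : ∀ u, u ∉ S → u - q ∉ S → u ≠ x + p → u ≠ x + p + q → u + p ∉ T := by
    intro u; rw [memT]; grind
  have f3 : ∀ u, u ∈ S ∨ u - p ∈ S → u ≠ x + p → u ∉ T := by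
    intro u; rw [memT]; grind
  have f4 : ∀ u, u ∈ S ∨ u - p ∈ S → u ≠ x + p → u + q ∉ T := by
    intro u; rw [memT]; grind
  set G' := switchGraph p q S' with hG'
  have eP : ∀ u, u ∉ S' → u - q ∉ S' → G'.Reachable u (u + p) := fun u =>
    switchGraph_reachable_left
  have eQ : ∀ u, u ∈ S' ∨ u - p ∈ S' → G'.Reachable u (u + q) := fun u =>
    switchGraph_reachable_right
  have r1 : G'.Reachable (x + p - q) (x + p) := by
    convert eQ (x + p - q) (Or.inl ((mem _).2 (by tauto))) using 1; ring
  have r2 : G'.Reachable (x + p) (x + p + q) :=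
    eQ (x + p) (Or.inr (by rw [mem, add_sub_cancel_right]; tauto))
  have r3 : G'.Reachable (x + p + q) (x + 2 * p + q) := by
    convert eP (x + p + q) m2 (by rwa [add_sub_cancel_right]) using 1; ring
  have r4 : G'.Reachable (x + 2 * p) (x + 2 * p + q) := eQ _ (Or.inl ((mem _).2 (by tauto)))
  have r5 : G'.Reachable (x + 2 * p - q) (x + 2 * p) := by
    convert eQ (x + 2 * p - q) (Or.inr (by rw [mem]; left; ring)) using 1; ring
  have r6 : G'.Reachable (x + 3 * p) (x + 3 * p + q) :=
    eQ _ (Or.inr (by rw [mem]; right; left; ring))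
  have r7 : G'.Reachable (x + p - q) (x + 2 * p) :=
    r1.trans (r2.trans (r3.trans r4.symm))
  set φ : ZMod t → ZMod t := fun u => if u ∈ T then x + 3 * p else u with hφ
  have φT : ∀ u, u ∈ T → φ u = x + 3 * p := fun u hu => if_pos hu
  have φT' : ∀ u, u ∉ T → φ u = u := fun u hu => if_neg hu
  have hP : ∀ u, u ∉ S → u - q ∉ S → G'.Reachable (φ u) (φ (u + p)) := by
    intro u hu hu'
    by_cases c1 : u = x + p - q
    · have : u + p = x + 2 * p - q := by rw [c1]; ring
      rw [this, c1, φT' _ yT, φT' _ yT']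
      exact r7.trans r5.symm
    by_cases c2 : u = x + 2 * p
    · have : u + p = x + 3 * p := by rw [c2]; ring
      rw [φT u (by rw [memT]; tauto), this]
      by_cases c : x + 3 * p ∈ T
      · rw [φT _ c]
      · rw [φT' _ c]
    by_cases c3 : u = x + p
    · have : u + p = x + 2 * p := by rw [c3]; ring
      rw [φT u (by rw [memT]; tauto), φT (u + p) (by rw [memT]; tauto)]
    by_cases c4 : u = x + 2 * p + q
    · rw [φT u (by rw [memT]; tauto)]
      by_cases c : u + p ∈ T
      · rw [φT _ c]
      · rw [φT' _ c]
        convert r6 using 1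
        rw [c4]; ring
    by_cases c5 : u = x + p + q
    · have : u + p = x + 2 * p + q := by rw [c5]; ring
      rw [φT u (by rw [memT]; tauto), φT (u + p) (by rw [memT]; tauto)]
    rw [φT' u (by rw [memT]; tauto), φT' (u + p) (f2 u hu hu' c3 c5)]
    exact eP u (by rw [mem]; tauto) (f1 u hu' c3 c4)
  have hQ : ∀ u, u ∈ S ∨ u - p ∈ S → G'.Reachable (φ u) (φ (u + q)) := by
    intro u hu
    by_cases c1 : u = x + p
    · have : u + q = x + p + q := by rw [c1]
      rw [φT u (by rw [memT]; tauto), φT (u + q) (by rw [memT]; tauto)]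
    rw [φT' u (f3 u hu c1), φT' (u + q) (f4 u hu c1)]
    exact eQ u (by rw [mem, mem]; tauto)
  have hmap : ∀ v w, G'.Reachable (φ v) (φ w) := by
    intro v w
    refine reachable_map_of_adj φ (fun u w h => ?_) (hS v w)
    rw [switchGraph_adj] at h
    rcases h.2 with (⟨rfl, a, b⟩ | ⟨rfl, a⟩) | ⟨rfl, a, b⟩ | ⟨rfl, a⟩
    · exact hP u a b
    · exact hQ u a
    · exact (hP w a b).symm
    · exact (hQ w a).symm
  have hy : ∀ v, G'.Reachable v (x + p - q) := by
    intro v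
    by_cases c : v ∈ T
    · rcases (memT v).1 c with rfl | rfl | rfl | rfl
      · exact r1.symm
      · exact r7.symm
      · exact r2.symm.trans r1.symm
      · exact r4.symm.trans r7.symm
    · have := hmap v (x + p - q)
      rwa [φT' v c, φT' _ yT] at this
  exact (hy v).trans (hy w).symm

/-- The integers below `m`, continued by alternating steps of `2 * p - 1` and `1`. -/
def zigzag {t : ℕ} (m : ℕ) (p : ZMod t) (r : ℕ) : ZMod t :=
  if r < m then r
  else if Even (r - m) then m - 2 + (r - m + 2 : ℕ) * p
  else m - 1 + (r - m + 1 : ℕ) * p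

section zigzag

variable {t m : ℕ} {p q : ZMod t}

lemma zigzag_of_lt {r : ℕ} (h : r < m) : zigzag m p r = r := if_pos h

lemma zigzag_add_even (i : ℕ) :
    zigzag m p (m + 2 * i) = m - 2 + (2 * i + 2) * p := by
  rw [zigzag, if_neg (by omega), if_pos (by grind)]
  simp

lemma zigzag_add_odd (i : ℕ) :
    zigzag m p (m + 2 * i + 1) = m - 1 + (2 * i + 2) * p := by
  rw [zigzag, if_neg (by omega), if_neg (by grind)]
  have : m + 2 * i + 1 - m + 1 = 2 * i + 2 := by omega
  rw [this]
  push_cast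
  rfl

lemma zigzag_cases (m r : ℕ) : r < m ∨ (∃ i, r = m + 2 * i) ∨ ∃ i, r = m + 2 * i + 1 := by
  rcases Nat.lt_or_ge r m with h | h
  · exact Or.inl h
  · obtain ⟨j, rfl⟩ := Nat.exists_eq_add_of_le h
    obtain ⟨i, rfl | rfl⟩ := Nat.even_or_odd' j
    · exact Or.inr (Or.inl ⟨i, rfl⟩)
    · exact Or.inr (Or.inr ⟨i, rfl⟩)

lemma zigzag_last (hm : 0 < m) (i : ℕ) :
    zigzag m p (m + 2 * i - 1) = m - 1 + 2 * i * p := by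
  rcases i with _ | i
  · rw [zigzag_of_lt (by omega), Nat.cast_sub (by omega)]
    simp
  · have : m + 2 * (i + 1) - 1 = m + 2 * i + 1 := by omega
    rw [this, zigzag_add_odd]
    push_cast
    ring

lemma map_zigzag {h : ℕ} (ρ : ZMod t →+* ZMod h) (hp : ρ p = 1) (r : ℕ) :
    ρ (zigzag m p r) = r := by
  rcases zigzag_cases m r with h | ⟨i, rfl⟩ | ⟨i, rfl⟩
  · rw [zigzag_of_lt h, map_natCast]
  · rw [zigzag_add_even]
    simp only [map_add, map_sub, map_mul, map_natCast, map_ofNat, hp]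
    push_cast
    ring
  · rw [zigzag_add_odd]
    simp only [map_add, map_sub, map_mul, map_natCast, map_ofNat, map_one, hp]
    push_cast
    ring

lemma zigzag_succ (hm : 0 < m) (hpq : p + q = 1) (r : ℕ) :
    zigzag m p (r + 1) = zigzag m p r + p + q ∨ zigzag m p (r + 1) = zigzag m p r + p - q := by
  obtain rfl : q = 1 - p := by rw [← hpq]; ring
  rcases zigzag_cases m r with h | ⟨i, rfl⟩ | ⟨i, rfl⟩
  · rcases Nat.lt_or_ge (r + 1) m with h' | h'
    · rw [zigzag_of_lt h, zigzag_of_lt h']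
      push_cast
      left; ring
    · obtain rfl : m = r + 1 := by omega
      have := zigzag_add_even (m := r + 1) (p := p) 0
      simp only [mul_zero, add_zero] at this
      rw [this, zigzag_of_lt h]
      push_cast
      right; ring
  · rw [zigzag_add_even, zigzag_add_odd]
    left; ring
  · have := zigzag_add_even (m := m) (p := p) (i + 1)
    rw [show m + 2 * i + 1 + 1 = m + 2 * (i + 1) by ring, this, zigzag_add_odd]
    push_cast
    right; ring

end zigzag

/-- If `p + q = 1`, then switching at a zigzag turns the graphs of all edges `u — u + p`, and
of all edges `u — u + q`, into two Hamilton cycles. -/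
lemma switchGraph_zigzag {t g h m k : ℕ} [NeZero t] {p q : ZMod t} (hpq : p + q = 1)
    (hp : 2 * p ≠ 0) (hq : 2 * q ≠ 0) (hne : p ≠ q)
    (ρg : ZMod t →+* ZMod g) (hgp : ρg p = 0) (hgker : ∀ y, ρg y = 0 → ∃ i : ℕ, y = i * p)
    (ρh : ZMod t →+* ZMod h) (hhq : ρh q = 0) (hhker : ∀ y, ρh y = 0 → ∃ i : ℕ, y = i * q)
    (hm : Odd m) (hmg : m = g ∨ m + 1 = g) (hL : m + 2 * k = h ∨ m + 2 * k + 1 = h)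
    {S : Set (ZMod t)} (hS : S = {y | ∃ r < m + 2 * k, y = zigzag m p r}) :
    (∀ x ∈ S, x + p ∉ S ∧ x + q ∉ S) ∧ (∀ v w, (switchGraph q p S).Reachable v w) ∧
      ∀ v w, (switchGraph p q S).Reachable v w := by
  have hm0 : 0 < m := hm.pos
  have hp0 : p ≠ 0 := by rintro rfl; simp at hp
  have hq0 : q ≠ 0 := by rintro rfl; simp at hq
  have hhp : ρh p = 1 := by
    have := congrArg ρh hpq
    rwa [map_add, map_one, hhq, add_zero] at this
  have hgq : ρg q = 1 := by
    have := congrArg ρg hpq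
    rwa [map_add, map_one, hgp, zero_add] at this
  have hinj : ∀ {n : ℕ}, ∀ a < n, ∀ b < n, (a : ZMod n) = b → a = b := by
    intro n a ha b hb hab
    rwa [ZMod.natCast_eq_natCast_iff', Nat.mod_eq_of_lt ha, Nat.mod_eq_of_lt hb] at hab
  have hmem : ∀ {n a : ℕ}, n ≤ h → a < h → ∀ {w}, ρh w = a →
      (∃ r < n, w = zigzag m p r) → a < n ∧ w = zigzag m p a := by
    rintro n a hn ha w hw ⟨r, hr, rfl⟩
    rw [map_zigzag ρh hhp] at hw
    obtain rfl := hinj r (by omega) a ha hw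
    exact ⟨hr, rfl⟩
  refine ⟨?_, ?_, ?_⟩
  · subst hS
    rintro x ⟨r, hr, rfl⟩
    constructor
    · rintro ⟨r', hr', he⟩
      have hc := congrArg ρh he
      rw [map_add, map_zigzag ρh hhp, map_zigzag ρh hhp, hhp] at hc
      rcases Nat.lt_or_ge (r + 1) h with hlt | hge
      · obtain rfl : r' = r + 1 := hinj r' (by omega) (r + 1) hlt (by push_cast; exact hc.symm)
        rcases zigzag_succ (p := p) (q := q) hm0 hpq r with h1 | h1
        · exact hq0 (by linear_combination -he - h1)
        · exact hq0 (by linear_combination he + h1)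
      · obtain rfl : r = m + 2 * k - 1 := by omega
        have hLh : m + 2 * k = h := by omega
        have hr0 : r' = 0 := by
          refine hinj (n := h) r' (by omega) 0 (by omega) ?_
          rw [← hc, Nat.cast_sub (by omega), hLh, ZMod.natCast_self]
          simp
        rw [hr0, zigzag_of_lt hm0, zigzag_last hm0, Nat.cast_zero] at he
        rcases Nat.lt_or_ge 1 m with h1 | h1
        · have hc' := congrArg ρg he
          simp only [map_add, map_sub, map_mul, map_natCast, map_ofNat, map_one, hgp,
            map_zero, mul_zero, add_zero] at hc'
          have := hinj (n := g) (m - 1) (by omega) 0 (by omega)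
            (by rw [Nat.cast_sub (by omega)]; simpa using hc')
          omega
        · obtain rfl : m = 1 := by omega
          obtain ⟨i, hi⟩ := hgker g (by rw [map_natCast, ZMod.natCast_self])
          have hhh : (h : ZMod t) = 1 + 2 * k := by rw [← hLh]; push_cast; rfl
          have hhp' : (h : ZMod t) * p = 0 := by
            rw [hhh]; rw [Nat.cast_one] at he; linear_combination he
          have h2 : (2 : ZMod t) * h = 0 := by
            have : (g : ZMod t) * h = 0 := by rw [hi]; linear_combination (i : ZMod t) * hhp'
            rcases hmg with hg1 | hg1
            · rw [← hg1, Nat.cast_one, one_mul] at this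
              rw [this, mul_zero]
            · rw [← hg1] at this
              push_cast at this
              linear_combination this
          have hqv : ((q.val : ℕ) : ZMod t) = q := ZMod.natCast_zmod_val q
          have : ((q.val : ℕ) : ZMod h) = 0 := by rw [← map_natCast ρh, hqv, hhq]
          rw [ZMod.natCast_eq_zero_iff] at this
          obtain ⟨j, hj⟩ := this
          rw [hj] at hqv
          refine hq ?_
          rw [← hqv]
          push_cast
          linear_combination (j : ZMod t) * h2
    · intro hin
      obtain ⟨-, he⟩ := hmem (n := m + 2 * k) (a := r) (by omega) (by omega)
        (by rw [map_add, map_zigzag ρh hhp, hhq, add_zero]) hin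
      exact hq0 (by linear_combination he)
  · exact switchGraph_reachable_of_ringHom ρh hhq hhp hhker (zigzag m p) 0
      (fun r _ => by rw [map_zigzag ρh hhp r, zero_add]) (by grind) hL (by simp [hS])
  · rw [hS]
    have hLh : m + 2 * k ≤ h := by omega
    clear hL hS S
    induction k with
    | zero =>
      exact switchGraph_reachable_of_ringHom ρg hgp hgq hgker
        (fun r => (r : ZMod t)) 0 (fun r _ => by rw [map_natCast ρg r, zero_add]) hm hmg (fun y => by
          constructor
          · rintro ⟨r, hr, rfl⟩
            exact ⟨r, hr, zigzag_of_lt hr⟩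
          · rintro ⟨r, hr, rfl⟩
            exact ⟨r, hr, (zigzag_of_lt hr).symm⟩)
    | succ k ih =>
      have ih := ih (by omega)
      have : Fact (1 < h) := ⟨by omega⟩
      set S := {y | ∃ r < m + 2 * k, y = zigzag m p r} with hS
      set x := zigzag m p (m + 2 * k - 1) with hx
      have hlast : x = m - 1 + 2 * k * p := zigzag_last hm0 k
      have hS' : {y | ∃ r < m + 2 * (k + 1), y = zigzag m p r} =
          insert (x + p - q) (insert (x + 2 * p) S) := by
        obtain rfl : q = 1 - p := by rw [← hpq]; ring
        have e1 : zigzag m p (m + 2 * k) = x + p - (1 - p) := by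
          rw [zigzag_add_even, hlast]; ring
        have e2 : zigzag m p (m + 2 * k + 1) = x + 2 * p := by
          rw [zigzag_add_odd, hlast]; ring
        ext y
        simp only [Set.mem_ofPred_eq, Set.mem_insert_iff, hS, ← e1, ← e2]
        constructor
        · rintro ⟨r, hr, rfl⟩
          rcases Nat.lt_or_ge r (m + 2 * k) with h1 | h1
          · exact Or.inr (Or.inr ⟨r, h1, rfl⟩)
          · obtain rfl | rfl : r = m + 2 * k ∨ r = m + 2 * k + 1 := by omega
            · exact Or.inl rfl
            · exact Or.inr (Or.inl rfl)
        · rintro (rfl | rfl | ⟨r, hr, rfl⟩)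
          · exact ⟨_, by omega, rfl⟩
          · exact ⟨_, by omega, rfl⟩
          · exact ⟨r, by omega, rfl⟩
      have hρx : ρh x = (m + 2 * k - 1 : ℕ) := map_zigzag ρh hhp _
      have hρx1 : ρh (x + p) = (m + 2 * k : ℕ) := by
        rw [map_add, hρx, hhp, Nat.cast_sub (by omega)]; push_cast; ring
      have hρx2 : ρh (x + 2 * p) = (m + 2 * k + 1 : ℕ) := by
        rw [two_mul, ← add_assoc, map_add, hρx1, hhp]; push_cast; ring
      have hρ : ∀ w, ρh (w + q) = ρh w ∧ ρh (w - q) = ρh w := by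
        intro w; rw [map_add, map_sub, hhq, add_zero, sub_zero]; exact ⟨rfl, rfl⟩
      have hnot : ∀ w, ρh w = (m + 2 * k : ℕ) → w ∉ S := by
        intro w hw hin
        have := (hmem (n := m + 2 * k) (by omega) (by omega) hw hin).1
        omega
      have hnot' : ∀ w, ρh w = (m + 2 * k + 1 : ℕ) → w ∉ S := by
        intro w hw hin
        have := (hmem (n := m + 2 * k) (by omega) (by omega) hw hin).1
        omega
      have hnot'' : ∀ w, w ≠ x → ρh w = ρh x → w ∉ S := by
        intro w hwx hw hin
        exact hwx (hmem (n := m + 2 * k) (a := m + 2 * k - 1) (by omega) (by omega)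
          (hw.trans hρx) hin).2
      have hρ1 : ∀ w, ρh w = 1 → w ≠ 0 := by
        rintro w hw rfl
        rw [map_zero] at hw
        exact zero_ne_one hw
      rw [hS']
      refine switchGraph_reachable_insert hp0 hq hne (by
          rw [hpq]; exact hρ1 1 (map_one _))
        (hρ1 _ (by simp [hhp, hhq])) ?_ ⟨_, by omega, hx⟩ (hnot _ hρx1)
        (hnot _ ((hρ _).2.trans hρx1)) (hnot' _ hρx2) (hnot _ ((hρ _).1.trans hρx1))
        (hnot'' _ (by simpa using hq0) (hρ _).1) (hnot' _ ((hρ _).1.trans hρx2))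
        (hnot'' _ (by simpa using hq0) (hρ _).2) (hnot' _ ((hρ _).2.trans hρx2)) ih
      rw [← sub_ne_zero]
      exact hρ1 _ (by simp [hhp, hhq])

/-- As `CirculantHamFactorization`, with an arbitrary finite type indexing the cycles. -/
def HasHamFactorization {t : ℕ} [NeZero t] (D : Finset (ZMod t)) : Prop :=
  ∃ (ι : Type) (_ : Fintype ι) (σ : ι → Perm (ZMod t)),
    (∀ j, (σ j).IsCycle ∧ (σ j).support = Finset.univ) ∧
    (∀ j i, σ j i - i ∈ D) ∧
    (∀ i, ∀ d ∈ D, ∃! j, σ j i = i + d)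

section HasHamFactorization

variable {t : ℕ} [NeZero t] {D D₁ D₂ : Finset (ZMod t)}

lemma HasHamFactorization.circulantHamFactorization (h : HasHamFactorization D) :
    CirculantHamFactorization t D := by
  obtain ⟨ι, _, σ, h1, h2, h3⟩ := h
  have hcard : Fintype.card ι = D.card := by
    rw [← Fintype.card_coe D]
    refine Fintype.card_of_bijective (f := fun j => (⟨σ j 0 - 0, h2 j 0⟩ : D)) ⟨?_, ?_⟩
    · intro j j' hj
      rw [Subtype.mk.injEq] at hj
      exact (h3 0 _ (h2 j 0)).unique (by ring) (by rw [hj]; ring)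
    · rintro ⟨d, hd⟩
      obtain ⟨j, hj, -⟩ := h3 0 d hd
      exact ⟨j, by simp [hj]⟩
  set e := Fintype.equivFinOfCardEq hcard
  refine ⟨fun k => σ (e.symm k), fun k => ?_, fun k i => h2 _ i, fun i d hd => ?_⟩
  · rw [(h1 _).1.cycleType, (h1 _).2, Finset.card_univ, ZMod.card]
  · obtain ⟨j, hj, hj'⟩ := h3 i d hd
    refine ⟨e j, by simpa using hj, fun k hk => ?_⟩
    rw [← hj' _ hk, e.apply_symm_apply]

lemma HasHamFactorization.union (h₁ : HasHamFactorization D₁) (h₂ : HasHamFactorization D₂)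
    (hD : Disjoint D₁ D₂) : HasHamFactorization (D₁ ∪ D₂) := by
  obtain ⟨ι₁, _, σ₁, a1, a2, a3⟩ := h₁
  obtain ⟨ι₂, _, σ₂, b1, b2, b3⟩ := h₂
  rw [Finset.disjoint_left] at hD
  refine ⟨ι₁ ⊕ ι₂, inferInstance, Sum.elim σ₁ σ₂, ?_, ?_, ?_⟩
  · rintro (j | j)
    · exact a1 j
    · exact b1 j
  · rintro (j | j) i
    · exact Finset.mem_union_left _ (a2 j i)
    · exact Finset.mem_union_right _ (b2 j i)
  · intro i d hd
    rcases Finset.mem_union.1 hd with hd | hd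
    · obtain ⟨j, hj, hj'⟩ := a3 i d hd
      refine ⟨Sum.inl j, hj, ?_⟩
      rintro (k | k) hk
      · rw [hj' k hk]
      · refine absurd ?_ (hD hd)
        have := b2 k i
        rw [Sum.elim_inr] at hk
        rwa [hk, add_sub_cancel_left] at this
    · obtain ⟨j, hj, hj'⟩ := b3 i d hd
      refine ⟨Sum.inr j, hj, ?_⟩
      rintro (k | k) hk
      · refine absurd hd (hD ?_)
        have := a2 k i
        rw [Sum.elim_inl] at hk
        rwa [hk, add_sub_cancel_left] at this
      · rw [hj' k hk]

lemma hasHamFactorization_singleton [Nontrivial (ZMod t)] {d : ZMod t} (hd : IsUnit d) :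
    HasHamFactorization {d} := by
  obtain ⟨e, he⟩ := hd.exists_left_inv
  have hpow : ∀ (n : ℕ) (x : ZMod t), (Equiv.addRight d ^ n) x = x + n * d := by
    intro n x
    induction n with
    | zero => simp
    | succ n ih =>
      rw [pow_succ', Perm.mul_apply, ih, Equiv.coe_addRight]
      push_cast
      ring
  refine ⟨Unit, inferInstance, fun _ => Equiv.addRight d, fun _ => ⟨⟨0, ?_, ?_⟩, ?_⟩, ?_, ?_⟩
  · simpa using hd.ne_zero
  · intro y _
    refine ⟨((y * e).val : ℕ), ?_⟩
    rw [zpow_natCast, hpow, ZMod.natCast_zmod_val, mul_assoc, he]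
    ring
  · ext x
    simpa using hd.ne_zero
  · intro _ i
    simp
  · intro i d' hd'
    rw [Finset.mem_singleton] at hd'
    exact ⟨(), by simp [hd'], fun _ _ => rfl⟩

lemma hasHamFactorization_of_traversedBy {ι : Type} [Fintype ι] (E : Finset (ZMod t))
    (hD : ∀ d, d ∈ D ↔ d ∈ E ∨ -d ∈ E) (G : ι → SimpleGraph (ZMod t))
    (hG : ∀ k, ∃ σ, TraversedBy (G k) σ) (hE : ∀ v, ∀ d ∈ E, ∃! k, (G k).Adj v (v + d))
    (hGD : ∀ k v w, (G k).Adj v w → w - v ∈ D) : HasHamFactorization D := by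
  choose σ hσ using hG
  refine ⟨ι × Bool, inferInstance, fun k => if k.2 then σ k.1 else (σ k.1)⁻¹, ?_, ?_, ?_⟩
  · rintro ⟨k, _ | _⟩
    · exact ⟨(hσ k).inv.isCycle, (hσ k).inv.support⟩
    · exact ⟨(hσ k).isCycle, (hσ k).support⟩
  · rintro ⟨k, _ | _⟩ i
    · exact hGD k _ _ (((hσ k).adj _ _).2 (Or.inr rfl))
    · exact hGD k _ _ (((hσ k).adj _ _).2 (Or.inl rfl))
  · intro i d hd
    have hex : ∃! k, (G k).Adj i (i + d) := by
      rcases (hD d).1 hd with h | h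
      · exact hE i d h
      · have := hE (i + d) _ h
        simp only [add_neg_cancel_right] at this
        simpa only [SimpleGraph.adj_comm] using this
    obtain ⟨k, hk, hk'⟩ := hex
    have hne := (hσ k).ne i
    have huniq : ∀ k' (b : Bool), (if b then σ k' else (σ k')⁻¹) i = i + d → k' = k := by
      rintro k' (_ | _) h
      · exact hk' k' (((hσ k').adj _ _).2 (Or.inr h.symm))
      · exact hk' k' (((hσ k').adj _ _).2 (Or.inl h.symm))
    rcases ((hσ k).adj _ _).1 hk with h | h
    · refine ⟨(k, true), h.symm, ?_⟩
      rintro ⟨k', b⟩ hb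
      obtain rfl := huniq k' b hb
      rcases b with _ | _
      · exact absurd (h.symm.trans hb.symm) hne
      · rfl
    · refine ⟨(k, false), h.symm, ?_⟩
      rintro ⟨k', b⟩ hb
      obtain rfl := huniq k' b hb
      rcases b with _ | _
      · rfl
      · exact absurd (hb.trans h) hne

end HasHamFactorization

/-- Reduction modulo the greatest common divisor of `a` and `t`. -/
lemma exists_ringHom_ker {t : ℕ} [NeZero t] (a : ℤ) {g : ℕ} (hg : Int.gcd a t = g) :
    ∃ ρ : ZMod t →+* ZMod g, ρ a = 0 ∧ ∀ y, ρ y = 0 → ∃ i : ℕ, y = i * a := by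
  have hgt : g ∣ t := by
    rw [← hg]; exact_mod_cast Int.gcd_dvd_right a t
  have hga : (g : ℤ) ∣ a := by rw [← hg]; exact Int.gcd_dvd_left a t
  refine ⟨ZMod.castHom hgt _, ?_, fun y hy => ?_⟩
  · rw [map_intCast, ZMod.intCast_zmod_eq_zero_iff_dvd]
    exact hga
  · have hb : (g : ZMod t) = a * (Int.gcdA a t : ℤ) := by
      have := congrArg (Int.cast : ℤ → ZMod t) (Int.gcd_eq_gcd_ab a t)
      rw [hg] at this
      push_cast at this
      rw [this]
      simp
    have hyv : ((y.val : ℕ) : ZMod t) = y := ZMod.natCast_zmod_val y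
    have : ((y.val : ℕ) : ZMod g) = 0 := by
      rw [← map_natCast (ZMod.castHom hgt (ZMod g)), hyv, hy]
    rw [ZMod.natCast_eq_zero_iff] at this
    obtain ⟨j, hj⟩ := this
    refine ⟨((j : ZMod t) * (Int.gcdA a t : ℤ)).val, ?_⟩
    rw [ZMod.natCast_zmod_val, ← hyv, hj, Nat.cast_mul, hb]
    ring

/-- The edges `u — u + p` and `u — u + q` decompose into two Hamilton cycles if `p + q = 1`. -/
lemma exists_traversedBy_switchGraph_zigzag {t g h m k : ℕ} [NeZero t] {a b : ℤ}
    {p q : ZMod t} (ha : (a : ZMod t) = p) (hb : (b : ZMod t) = q) (hpq : p + q = 1)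
    (hp : 2 * p ≠ 0) (hq : 2 * q ≠ 0) (hne : p ≠ q)
    (hg : Int.gcd a t = g) (hh : Int.gcd b t = h)
    (hm : Odd m) (hmg : m = g ∨ m + 1 = g) (hL : m + 2 * k = h ∨ m + 2 * k + 1 = h)
    {S : Set (ZMod t)} (hS : S = {y | ∃ r < m + 2 * k, y = zigzag m p r}) :
    (∃ σ, TraversedBy (switchGraph q p S) σ) ∧ ∃ σ, TraversedBy (switchGraph p q S) σ := by
  obtain ⟨ρg, g1, g2⟩ := exists_ringHom_ker a hg
  obtain ⟨ρh, h1, h2⟩ := exists_ringHom_ker b hh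
  rw [ha] at g1 g2
  rw [hb] at h1 h2
  have h10 : (1 : ZMod t) ≠ 0 := by
    intro h0
    exact hp (by rw [← one_mul (2 * p), h0, zero_mul])
  obtain ⟨c1, c2, c3⟩ := switchGraph_zigzag hpq hp hq hne ρg g1 g2 ρh h1 h2 hm hmg hL hS
  refine ⟨exists_traversedBy _ (switchGraph_neighbors hp hq hne (by rwa [hpq]) c1) c2,
    exists_traversedBy _ (switchGraph_neighbors hq hp hne.symm (by rwa [add_comm, hpq])
      fun x hx => (c1 x hx).symm) c3⟩

section pmSet

variable {t : ℕ}

lemma mem_pmSet {lo hi : ℕ} {d : ZMod t} :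
    d ∈ pmSet t lo hi ↔ ∃ j : ℕ, (lo ≤ j ∧ j ≤ hi) ∧ (d = j ∨ d = -j) := by
  simp only [pmSet, Finset.mem_union, Finset.mem_image, Finset.mem_Icc]
  grind

lemma mem_pmSet_two_four {d : ZMod t} :
    d ∈ pmSet t 2 4 ↔ (d = 4 ∨ d = -3 ∨ d = -2) ∨ (d = -4 ∨ d = 3 ∨ d = 2) := by
  rw [mem_pmSet]
  constructor
  · rintro ⟨j, ⟨hj, hj'⟩, h⟩
    interval_cases j <;> push_cast at h <;> rcases h with h | h <;> rw [h] <;> simp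
  · rintro ((h | h | h) | (h | h | h))
    · exact ⟨4, by omega, Or.inl (by simpa using h)⟩
    · exact ⟨3, by omega, Or.inr (by simpa using h)⟩
    · exact ⟨2, by omega, Or.inr (by simpa using h)⟩
    · exact ⟨4, by omega, Or.inr (by simpa using h)⟩
    · exact ⟨3, by omega, Or.inl (by simpa using h)⟩
    · exact ⟨2, by omega, Or.inl (by simpa using h)⟩

lemma natCast_ne_zero_of_lt {n : ℕ} (h0 : 0 < n) (h : n < t) : (n : ZMod t) ≠ 0 := by
  rw [Ne, ZMod.natCast_eq_zero_iff]
  exact Nat.not_dvd_of_pos_of_lt h0 h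

lemma pmSet_union {a b c : ℕ} (hab : a ≤ b + 1) (hbc : b ≤ c) :
    pmSet t a b ∪ pmSet t (b + 1) c = pmSet t a c := by
  ext d
  simp only [Finset.mem_union, mem_pmSet]
  constructor
  · rintro (⟨j, hj, h⟩ | ⟨j, hj, h⟩)
    · exact ⟨j, by omega, h⟩
    · exact ⟨j, by omega, h⟩
  · rintro ⟨j, hj, h⟩
    rcases Nat.lt_or_ge b j with hb | hb
    · exact Or.inr ⟨j, by omega, h⟩
    · exact Or.inl ⟨j, by omega, h⟩

lemma pmSet_disjoint {a b c e : ℕ} (hbc : b < c) (he : 2 * e < t) :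
    Disjoint (pmSet t a b) (pmSet t c e) := by
  rw [Finset.disjoint_left]
  intro d h1 h2
  obtain ⟨i, hi, h1⟩ := mem_pmSet.1 h1
  obtain ⟨j, hj, h2⟩ := mem_pmSet.1 h2
  have e1 : ((j - i : ℕ) : ZMod t) ≠ 0 := natCast_ne_zero_of_lt (by omega) (by omega)
  have e2 : ((j + i : ℕ) : ZMod t) ≠ 0 := natCast_ne_zero_of_lt (by omega) (by omega)
  rw [Nat.cast_sub (by omega)] at e1
  push_cast at e2
  grind

lemma hasHamFactorization_empty [NeZero t] : HasHamFactorization (∅ : Finset (ZMod t)) :=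
  ⟨Empty, inferInstance, Empty.elim, fun j => j.elim, fun j => j.elim, by simp⟩

lemma hasHamFactorization_of_switchGraph [NeZero t] {p q : ZMod t} {S : Set (ZMod t)}
    {D : Finset (ZMod t)} (hp : 2 * p ≠ 0) (hq : 2 * q ≠ 0) (hne : p ≠ q) (hpq : p + q ≠ 0)
    (h₁ : ∃ σ, TraversedBy (switchGraph q p S) σ) (h₂ : ∃ σ, TraversedBy (switchGraph p q S) σ)
    (hD : ∀ d, d ∈ D ↔ (d = p ∨ d = q) ∨ (-d = p ∨ -d = q)) : HasHamFactorization D := by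
  refine hasHamFactorization_of_traversedBy (ι := Bool) {p, q} (by simpa using hD)
    (fun b => if b then switchGraph q p S else switchGraph p q S) ?_ ?_ ?_
  · rintro (_ | _)
    · exact h₂
    · exact h₁
  · intro v d hd
    have hqp : q + p ≠ 0 := by rwa [add_comm]
    rw [Finset.mem_insert, Finset.mem_singleton] at hd
    have key : ∀ A B : Prop, (A ↔ ¬ B) →
        ∃! b : Bool, if b then A else B := by
      intro A B h
      by_cases hB : B
      · refine ⟨false, by simpa, ?_⟩
        rintro (_ | _) hh
        · rfl
        · simp only [if_true] at hh; tauto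
      · refine ⟨true, by simpa using h.2 hB, ?_⟩
        rintro (_ | _) hh
        · simp only [Bool.false_eq_true, if_false] at hh; tauto
        · rfl
    have := key ((switchGraph q p S).Adj v (v + d)) ((switchGraph p q S).Adj v (v + d)) (by
      rcases hd with rfl | rfl
      · rw [switchGraph_adj_right hp hne hpq, switchGraph_adj_left hp hne.symm hqp]
        tauto
      · rw [switchGraph_adj_left hq hne hpq, switchGraph_adj_right hq hne.symm hqp]
        tauto)
    obtain ⟨b, hb, hb'⟩ := this
    refine ⟨b, by rcases b with _ | _ <;> simpa using hb, fun c hc => hb' c ?_⟩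
    rcases c with _ | _ <;> simpa using hc
  · intro b v w h
    rw [hD]
    rcases b with _ | _
    · have := switchGraph_adj_sub (by simpa using h : (switchGraph p q S).Adj v w)
      grind
    · have := switchGraph_adj_sub (by simpa using h : (switchGraph q p S).Adj v w)
      grind

lemma hasHamFactorization_of_add_eq_one [NeZero t] {a b : ℤ} {p q : ZMod t}
    {D : Finset (ZMod t)} (ha : (a : ZMod t) = p) (hb : (b : ZMod t) = q) (hpq : p + q = 1)
    (hp : 2 * p ≠ 0) (hq : 2 * q ≠ 0) (hne : p ≠ q)
    (hD : ∀ d, d ∈ D ↔ (d = p ∨ d = q) ∨ (-d = p ∨ -d = q)) : HasHamFactorization D := by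
  wlog hle : Int.gcd a t ≤ Int.gcd b t generalizing a b p q
  · exact this hb ha (by rwa [add_comm]) hq hp hne.symm
      (fun d => by rw [hD, or_comm (a := d = p), or_comm (a := -d = p)]) (by omega)
  have hg : 0 < Int.gcd a t := Int.gcd_pos_of_ne_zero_right _ (by exact_mod_cast NeZero.ne t)
  obtain ⟨m, k, hm, hmg, hL⟩ : ∃ m k, Odd m ∧ (m = Int.gcd a t ∨ m + 1 = Int.gcd a t) ∧
      (m + 2 * k = Int.gcd b t ∨ m + 2 * k + 1 = Int.gcd b t) := by
    refine ⟨Int.gcd a t - 1 + Int.gcd a t % 2,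
      (Int.gcd b t - (Int.gcd a t - 1 + Int.gcd a t % 2)) / 2, ?_, ?_, ?_⟩
    · rw [Nat.odd_iff]; omega
    · omega
    · omega
  obtain ⟨h₁, h₂⟩ := exists_traversedBy_switchGraph_zigzag ha hb hpq hp hq hne rfl rfl hm hmg hL
    (S := _) rfl
  refine hasHamFactorization_of_switchGraph hp hq hne ?_ h₁ h₂ hD
  rw [hpq]
  intro h0
  exact hp (by rw [← one_mul (2 * p), h0, zero_mul])

lemma hasHamFactorization_pmSet_pair [NeZero t] {d : ℕ} (hd : 1 ≤ d) (hdt : 2 * (d + 1) < t) :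
    HasHamFactorization (pmSet t d (d + 1)) := by
  have e1 : ((2 * d : ℕ) : ZMod t) ≠ 0 := natCast_ne_zero_of_lt (by omega) (by omega)
  have e2 : ((2 * (d + 1) : ℕ) : ZMod t) ≠ 0 := natCast_ne_zero_of_lt (by omega) (by omega)
  have e3 : ((2 * d + 1 : ℕ) : ZMod t) ≠ 0 := natCast_ne_zero_of_lt (by omega) (by omega)
  push_cast at e1 e2 e3
  refine hasHamFactorization_of_add_eq_one (a := -(d : ℤ)) (b := (d : ℤ) + 1)
    (p := -(d : ZMod t)) (q := (d : ZMod t) + 1)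
    (by simp) (by simp) (by ring) (by simpa using e1) e2 ?_ fun x => ?_
  · intro h
    exact e3 (by linear_combination -h)
  · rw [mem_pmSet]
    constructor
    · rintro ⟨j, hj, h⟩
      obtain rfl | rfl : j = d ∨ j = d + 1 := by omega
      · grind
      · push_cast at h; grind
    · rintro ((h | h) | h | h)
      · exact ⟨d, by omega, Or.inr h⟩
      · exact ⟨d + 1, by omega, Or.inl (by push_cast; exact h)⟩
      · exact ⟨d, by omega, Or.inl (by simpa using h)⟩
      · exact ⟨d + 1, by omega, Or.inr (by push_cast; rw [← h]; ring)⟩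

lemma hasHamFactorization_pmSet [NeZero t] {lo hi n : ℕ} (hlo : 1 ≤ lo) (hhi : hi + 1 = lo + 2 * n)
    (ht : 2 * hi < t) : HasHamFactorization (pmSet t lo hi) := by
  induction n generalizing hi with
  | zero =>
    have : pmSet t lo hi = ∅ := by
      rw [pmSet, Finset.Icc_eq_empty (by omega)]
      simp
    rw [this]
    exact hasHamFactorization_empty
  | succ n ih =>
    obtain ⟨hi, rfl⟩ : ∃ k, hi = k + 2 := ⟨hi - 2, by omega⟩
    rw [← pmSet_union (b := hi) (by omega) (by omega)]
    exact (ih (by omega) (by omega)).union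
      (hasHamFactorization_pmSet_pair (by omega) (by omega)) (pmSet_disjoint (by omega) (by omega))

end pmSet

lemma TraversedBy.exists_switched {V : Type*} [Fintype V] [DecidableEq V] [Nonempty V]
    {G : SimpleGraph V} {σ : Perm V} (h : TraversedBy G σ) {y z : V} (hyz : y ≠ z)
    (hadj : ¬ G.Adj y z) (hadj' : ¬ G.Adj (σ y) (σ z)) :
    ∃ G' : SimpleGraph V, (∃ τ, TraversedBy G' τ) ∧
      ∀ v w, G'.Adj v w ↔ (G.Adj v w ∧ s(v, w) ≠ s(y, σ y) ∧ s(v, w) ≠ s(z, σ z)) ∨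
        s(v, w) = s(y, z) ∨ s(v, w) = s(σ y, σ z) := by
  have hG' : ∀ v w, (G.deleteEdges {s(y, σ y), s(z, σ z)} ⊔
      fromEdgeSet {s(y, z), s(σ y, σ z)}).Adj v w ↔
      (G.Adj v w ∧ s(v, w) ≠ s(y, σ y) ∧ s(v, w) ≠ s(z, σ z)) ∨
        s(v, w) = s(y, z) ∨ s(v, w) = s(σ y, σ z) := by
    intro v w
    rw [sup_adj, deleteEdges_adj, fromEdgeSet_adj, Set.mem_insert_iff, Set.mem_insert_iff,
      Set.mem_singleton_iff, Set.mem_singleton_iff, not_or]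
    refine or_congr_right (and_iff_left_of_imp ?_)
    rintro h rfl
    have hσ : σ y ≠ σ z := fun hh => hyz (σ.injective hh)
    simp only [Sym2.eq_iff] at h
    grind
  exact ⟨_, h.exists_switch hyz hadj hadj' hG', hG'⟩

lemma sym2_mk_add_eq_iff {A : Type*} [AddGroup A] {v d a e : A} :
    s(v, v + d) = s(a, a + e) ↔ (d = e ∧ v = a) ∨ (d = -e ∧ v = a + e) := by
  rw [Sym2.eq_iff]
  constructor
  · rintro (⟨rfl, h⟩ | ⟨rfl, h⟩)
    · exact Or.inl ⟨add_left_cancel h, rfl⟩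
    · refine Or.inr ⟨?_, rfl⟩
      rw [add_assoc, add_eq_left] at h
      exact eq_neg_of_add_eq_zero_right h
  · rintro (⟨rfl, rfl⟩ | ⟨rfl, rfl⟩)
    · exact Or.inl ⟨rfl, rfl⟩
    · exact Or.inr ⟨rfl, by simp⟩

lemma existsUnique_fin_three {P : Fin 3 → Prop} :
    (∃! k, P k) ↔ (P 0 ∧ ¬ P 1 ∧ ¬ P 2) ∨ (¬ P 0 ∧ P 1 ∧ ¬ P 2) ∨ (¬ P 0 ∧ ¬ P 1 ∧ P 2) := by
  simp only [ExistsUnique, Fin.exists_fin_succ, Fin.forall_fin_succ]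
  simp
  tauto

section triple

variable {t : ℕ} [NeZero t] {S : Set (ZMod t)}

lemma TraversedBy.apply_eq_iff {G : SimpleGraph (ZMod t)} {σ : Perm (ZMod t)}
    (h : TraversedBy G σ) {u a b : ZMod t} (ha : G.Adj u a) (hb : G.Adj u b) (hab : a ≠ b) :
    σ u = a ↔ σ b = u := by
  have h1 := (h.adj _ _).1 ha
  have h2 := (h.adj _ _).1 hb
  rw [Perm.eq_inv_iff_eq] at h1 h2
  constructor
  · rintro rfl
    exact h2.resolve_left hab.symm
  · intro hh
    refine (h1.resolve_right fun h3 => hab (σ.injective (h3.trans hh.symm))).symm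

/-- A Hamilton cycle with edges `x - j — x - j - 3` for the listed `j` traverses two of these
edges, at distance two, in the same direction. -/
lemma TraversedBy.exists_parallel {G : SimpleGraph (ZMod t)} {σ : Perm (ZMod t)}
    (h : TraversedBy G σ) (h6 : (6 : ZMod t) ≠ 0) {x : ZMod t}
    (hx : ∀ j ∈ ({0, 2, 3, 4, 6} : Finset ℕ), G.Adj (x - j) (x - j - 3)) :
    ∃ τ, TraversedBy G τ ∧ ∃ u, τ u = u - 3 ∧ τ (u - 2) = u - 2 - 3 := by
  have e0 := hx 0 (by decide)
  have e2 := hx 2 (by decide)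
  have e3 := hx 3 (by decide)
  have e4 := hx 4 (by decide)
  have e6 := hx 6 (by decide)
  push_cast at e0 e2 e3 e4 e6
  rw [sub_zero] at e0
  have s1 : x - 2 - 2 = x - 4 := by ring
  have s2 : x - 4 - 2 = x - 6 := by ring
  have s3 : x - 3 - 3 = x - 6 := by ring
  rw [s3] at e3
  have d1 : σ x = x - 3 ↔ σ (x - 3) = x - 6 := by
    rw [h.apply_eq_iff e3 e0.symm]
    intro hh
    exact h6 (by linear_combination -hh)
  have d2 : σ (x - 3) = x - 6 ↔ σ (x - 6) = x - 6 - 3 := by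
    rw [← h.apply_eq_iff e6 e3.symm]
    intro hh
    exact h6 (by linear_combination -hh)
  have main : ∀ u, G.Adj u (u - 3) → G.Adj (u - 2) (u - 2 - 3) →
      (σ u = u - 3 ↔ σ (u - 2) = u - 2 - 3) →
      ∃ τ, TraversedBy G τ ∧ ∃ u, τ u = u - 3 ∧ τ (u - 2) = u - 2 - 3 := by
    intro u h1 h2 h3
    by_cases hu : σ u = u - 3
    · exact ⟨σ, h, u, hu, h3.1 hu⟩
    · refine ⟨σ⁻¹, h.inv, u, ?_, ?_⟩
      · exact (((h.adj _ _).1 h1).resolve_left (Ne.symm hu)).symm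
      · exact (((h.adj _ _).1 h2).resolve_left fun hh => hu (h3.2 hh.symm)).symm
  by_cases c1 : σ x = x - 3 ↔ σ (x - 2) = x - 2 - 3
  · exact main x e0 e2 c1
  by_cases c2 : σ (x - 2) = x - 2 - 3 ↔ σ (x - 4) = x - 4 - 3
  · exact main (x - 2) e2 (by rwa [s1]) (by rwa [s1])
  · refine main (x - 4) e4 (by rwa [s2]) ?_
    rw [s2]
    tauto

lemma exists_traversedBy_switchGraph_singleton (ht : Even t) (h10 : 10 ≤ t) (u : ZMod t) :
    ∃ σ, TraversedBy (switchGraph (-2) (-3) {u}) σ := by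
  have hnz : ∀ n : ℕ, 0 < n → n < 10 → (n : ZMod t) ≠ 0 := fun n h0 h =>
    natCast_ne_zero_of_lt h0 (by omega)
  have e1 := hnz 1 (by omega) (by omega)
  have e2 := hnz 2 (by omega) (by omega)
  have e3 := hnz 3 (by omega) (by omega)
  have e4 := hnz 4 (by omega) (by omega)
  have e5 := hnz 5 (by omega) (by omega)
  have e6 := hnz 6 (by omega) (by omega)
  push_cast at e1 e2 e3 e4 e5 e6
  obtain ⟨ρ, h1, h2⟩ := exists_ringHom_ker (t := t) (-2) (g := 2) (by
    rw [Int.neg_gcd]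
    exact_mod_cast Nat.gcd_eq_left ht.two_dvd)
  push_cast at h1 h2
  refine exists_traversedBy _ (switchGraph_neighbors ?_ ?_ ?_ ?_ ?_)
    (switchGraph_reachable_of_ringHom ρ h1 ?_ h2 (fun _ => u) (ρ u) (L := 1) ?_ odd_one
      (Or.inr rfl) (by simp))
  · intro h; exact e6 (by linear_combination -h)
  · intro h; exact e4 (by linear_combination -h)
  · intro h; exact e1 (by linear_combination -h)
  · intro h; exact e5 (by linear_combination -h)
  · rintro y rfl
    simp only [Set.mem_singleton_iff, add_eq_left, neg_eq_zero]
    exact ⟨e3, e2⟩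
  · rw [map_neg, map_ofNat]; rfl
  · intro r hr
    obtain rfl : r = 0 := by omega
    simp

lemma hasHamFactorization_pmSet_two_four_of_switchGraph (ht : Even t) (h10 : 10 ≤ t)
    (h₁ : ∃ σ, TraversedBy (switchGraph (-3) 4 S) σ)
    (h₂ : ∃ σ, TraversedBy (switchGraph 4 (-3) S) σ) {x : ZMod t}
    (hx : ∀ j ∈ ({0, 2, 3, 4, 6} : Finset ℕ), x - j ∉ S ∧ x - j - 4 ∉ S) :
    HasHamFactorization (pmSet t 2 4) := by
  have hnz : ∀ n : ℕ, 0 < n → n < 10 → (n : ZMod t) ≠ 0 := fun n h0 h =>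
    natCast_ne_zero_of_lt h0 (by omega)
  have e1 := hnz 1 (by omega) (by omega)
  have e2 := hnz 2 (by omega) (by omega)
  have e4 := hnz 4 (by omega) (by omega)
  have e5 := hnz 5 (by omega) (by omega)
  have e6 := hnz 6 (by omega) (by omega)
  have e7 := hnz 7 (by omega) (by omega)
  have e8 := hnz 8 (by omega) (by omega)
  push_cast at e1 e2 e4 e5 e6 e7 e8
  have c1 : (2 : ZMod t) * -3 ≠ 0 := fun h => e6 (by linear_combination -h)
  have c2 : (2 : ZMod t) * 4 ≠ 0 := fun h => e8 (by linear_combination h)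
  have c3 : (4 : ZMod t) ≠ -3 := fun h => e7 (by linear_combination h)
  have c4 : (4 : ZMod t) + -3 ≠ 0 := fun h => e1 (by linear_combination h)
  have c5 : (-3 : ZMod t) + 4 ≠ 0 := fun h => e1 (by linear_combination h)
  have c6 : (2 : ZMod t) * -2 ≠ 0 := fun h => e4 (by linear_combination -h)
  have c7 : (-3 : ZMod t) ≠ -2 := fun h => e1 (by linear_combination -h)
  have c8 : (-3 : ZMod t) + -2 ≠ 0 := fun h => e5 (by linear_combination -h)
  have c9 : (4 : ZMod t) ≠ -2 := fun h => e6 (by linear_combination h)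
  have left : ∀ {v}, (switchGraph (-3) 4 S).Adj v (v + -3) ↔ v ∉ S ∧ v - 4 ∉ S :=
    switchGraph_adj_left c1 c3 c4
  have sub : ∀ {v d}, (switchGraph (-3) 4 S).Adj v (v + d) →
      d = -3 ∨ d = 3 ∨ d = 4 ∨ d = -4 := by
    intro v d h
    have := switchGraph_adj_sub h
    grind
  obtain ⟨σ₀, hσ₀⟩ := h₁
  obtain ⟨σ, hσ, u, hu, hu'⟩ := hσ₀.exists_parallel e6 (x := x) fun j hj => by
    rw [sub_eq_add_neg _ (3 : ZMod t), left]
    exact hx j hj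
  have hy := hσ.exists_switched (y := u) (z := u - 2) ?_ ?_ ?_
  rotate_left
  · intro h; exact e2 (by linear_combination h)
  · rw [sub_eq_add_neg]
    intro h
    rcases sub h with h | h | h | h
    · exact c7 h.symm
    · exact e5 (by linear_combination -h)
    · exact c9 h.symm
    · exact e2 (by linear_combination h)
  · rw [hu, hu', show u - 2 - 3 = u - 3 + -2 by ring]
    intro h
    rcases sub h with h | h | h | h
    · exact c7 h.symm
    · exact e5 (by linear_combination -h)
    · exact c9 h.symm
    · exact e2 (by linear_combination h)
  obtain ⟨G, hG, hadj⟩ := hy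
  have a1 : (switchGraph (-3) 4 S).Adj u (u + -3) := by
    rw [← sub_eq_add_neg, ← hu, hσ.adj]
    exact Or.inl rfl
  have a2 : (switchGraph (-3) 4 S).Adj (u - 2) (u - 2 + -3) := by
    rw [← sub_eq_add_neg, ← hu', hσ.adj]
    exact Or.inl rfl
  rw [left] at a1 a2
  have hadj' : ∀ v d, G.Adj v (v + d) ↔ ((switchGraph (-3) 4 S).Adj v (v + d) ∧
      ¬ ((d = -3 ∧ v = u) ∨ (d = 3 ∧ v = u + -3)) ∧
      ¬ ((d = -3 ∧ v = u - 2) ∨ (d = 3 ∧ v = u - 2 + -3))) ∨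
      ((d = -2 ∧ v = u) ∨ (d = 2 ∧ v = u + -2)) ∨
      ((d = -2 ∧ v = u - 3) ∨ (d = 2 ∧ v = u - 3 + -2)) := by
    intro v d
    have h := fun a => sym2_mk_add_eq_iff (v := v) (d := d) (a := a) (e := (-3 : ZMod t))
    have h' := fun a => sym2_mk_add_eq_iff (v := v) (d := d) (a := a) (e := (-2 : ZMod t))
    simp only [neg_neg] at h h'
    rw [hadj, hu, hu', ← h, ← h, ← h', ← h', ← sub_eq_add_neg, ← sub_eq_add_neg,
      ← sub_eq_add_neg, ← sub_eq_add_neg, sub_right_comm u 3 2]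
  have n1 : (4 : ZMod t) ≠ 3 := fun h => e1 (by linear_combination h)
  have n2 : (4 : ZMod t) ≠ 2 := fun h => e2 (by linear_combination h)
  have n3 : (-3 : ZMod t) ≠ 3 := fun h => e6 (by linear_combination -h)
  have n4 : (-3 : ZMod t) ≠ 2 := fun h => e5 (by linear_combination -h)
  have n5 : (-2 : ZMod t) ≠ 2 := fun h => e4 (by linear_combination -h)
  refine hasHamFactorization_of_traversedBy (ι := Fin 3) {4, -3, -2} ?_
    ![G, switchGraph 4 (-3) S, switchGraph (-2) (-3) {u}] ?_ ?_ ?_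
  · intro d
    simp only [mem_pmSet_two_four, Finset.mem_insert, Finset.mem_singleton, neg_eq_iff_eq_neg,
      neg_neg]
  · intro k
    fin_cases k
    · exact hG
    · exact h₂
    · exact exists_traversedBy_switchGraph_singleton ht h10 u
  · intro v d hd
    rw [existsUnique_fin_three]
    change (G.Adj v (v + d) ∧ ¬ (switchGraph 4 (-3) S).Adj v (v + d) ∧
      ¬ (switchGraph (-2) (-3) {u}).Adj v (v + d)) ∨
      (¬ G.Adj v (v + d) ∧ (switchGraph 4 (-3) S).Adj v (v + d) ∧
      ¬ (switchGraph (-2) (-3) {u}).Adj v (v + d)) ∨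
      (¬ G.Adj v (v + d) ∧ ¬ (switchGraph 4 (-3) S).Adj v (v + d) ∧
      (switchGraph (-2) (-3) {u}).Adj v (v + d))
    rw [hadj']
    simp only [Finset.mem_insert, Finset.mem_singleton] at hd
    rcases hd with rfl | rfl | rfl
    · have hG3 : ¬ (switchGraph (-2) (-3) {u}).Adj v (v + 4) := by
        intro h
        rcases switchGraph_adj_sub h with h | h | h | h
        · exact c9 (add_left_cancel h)
        · exact n2 (by linear_combination h)
        · exact c3 (add_left_cancel h)
        · exact n1 (by linear_combination h)
      rw [switchGraph_adj_right c2 c3 c4, switchGraph_adj_left c2 c3.symm c5,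
        sub_neg_eq_add]
      by_cases h₁ : v ∈ S <;> by_cases h₂ : v + 3 ∈ S <;> simp [hG3, c3, c9, n1, n2, h₁, h₂]
    · rw [left, switchGraph_adj_right c1 c3.symm c5, switchGraph_adj_right c1 c7 c8,
        Set.mem_singleton_iff, Set.mem_singleton_iff, sub_neg_eq_add, ← eq_sub_iff_add_eq]
      simp only [c7, n3, n4, true_and, false_and, or_false]
      by_cases h3 : v = u
      · simp [h3, a1]
      by_cases h4 : v = u - 2
      · simp [h4, a2, e2]
      by_cases h₁ : v ∈ S <;> by_cases h₂ : v - 4 ∈ S <;> simp [h3, h4, h₁, h₂]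
    · have hG1 : ¬ (switchGraph (-3) 4 S).Adj v (v + -2) := by
        intro h
        rcases sub h with h | h | h | h
        · exact c7 h.symm
        · exact e5 (by linear_combination -h)
        · exact c9 h.symm
        · exact e2 (by linear_combination h)
      have hG2 : ¬ (switchGraph 4 (-3) S).Adj v (v + -2) := by
        intro h
        rcases switchGraph_adj_sub h with h | h | h | h
        · exact c9 (add_left_cancel h).symm
        · exact e2 (by linear_combination h)
        · exact c7 (add_left_cancel h).symm
        · exact e5 (by linear_combination -h)
      rw [switchGraph_adj_left c6 c7 c8, Set.mem_singleton_iff, Set.mem_singleton_iff,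
        sub_neg_eq_add, ← eq_sub_iff_add_eq]
      simp only [hG1, hG2, n5, false_and, true_and, or_false, false_or, not_false_eq_true]
      by_cases h₁ : v = u <;> by_cases h₂ : v = u - 3 <;> simp [h₁, h₂]
  · intro k v w h
    obtain ⟨d, rfl⟩ : ∃ d, w = v + d := ⟨w - v, by ring⟩
    rw [add_sub_cancel_left]
    fin_cases k
    · rw [mem_pmSet_two_four]
      rcases (hadj' v d).1 h with ⟨h, -⟩ | (⟨h, -⟩ | ⟨h, -⟩) | ⟨h, -⟩ | ⟨h, -⟩
      · rcases sub h with h | h | h | h <;> rw [h] <;> simp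
      all_goals rw [h]; simp
    · have := switchGraph_adj_sub (show (switchGraph 4 (-3) S).Adj v (v + d) from h)
      rw [mem_pmSet_two_four]
      grind
    · have := switchGraph_adj_sub (show (switchGraph (-2) (-3) {u}).Adj v (v + d) from h)
      rw [mem_pmSet_two_four]
      grind

end triple

section pmSetTwoFour

variable {t : ℕ}

lemma intCast_ne_zero_of_natAbs_lt {c : ℕ} (ht : Even t) (hc : c ≤ t) {n : ℤ}
    (hn : n % 2 = 1 ∨ (n ≠ 0 ∧ n.natAbs < c)) : (n : ZMod t) ≠ 0 := by
  rw [Ne, ZMod.intCast_zmod_eq_zero_iff_dvd]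
  intro h
  rcases hn with hn | ⟨h0, hn⟩
  · have h2 : ((2 : ℕ) : ℤ) ∣ n := (Int.natCast_dvd_natCast.2 ht.two_dvd).trans h
    push_cast at h2
    omega
  · exact h0 (Int.eq_zero_of_abs_lt_dvd h (by rw [Int.abs_eq_natAbs]; omega))

lemma hasHamFactorization_pmSet_two_four_of_zigzag [NeZero t] {a b : ℤ} {c g h m k : ℕ}
    (ht : Even t) (h10 : 10 ≤ t) (hab : (a = -3 ∧ b = 4) ∨ (a = 4 ∧ b = -3))
    (hg : Int.gcd a t = g) (hh : Int.gcd b t = h) (hm : Odd m) (hmg : m = g ∨ m + 1 = g)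
    (hL : m + 2 * k = h ∨ m + 2 * k + 1 = h) (T : Finset ℤ)
    (hT : ∀ r < m + 2 * k, ∃ n ∈ T, zigzag m (a : ZMod t) r = n) (x : ℤ) (hc : c ≤ t)
    (hx : ∀ j ∈ ({0, 2, 3, 4, 6} : Finset ℕ), ∀ n ∈ T,
      ((x - j - n) % 2 = 1 ∨ (x - j - n ≠ 0 ∧ (x - j - n).natAbs < c)) ∧
      ((x - j - 4 - n) % 2 = 1 ∨ (x - j - 4 - n ≠ 0 ∧ (x - j - 4 - n).natAbs < c))) :
    HasHamFactorization (pmSet t 2 4) := by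
  have hnz : ∀ n : ℤ, n ≠ 0 ∧ n.natAbs < 10 → (n : ZMod t) ≠ 0 := fun n hn =>
    intCast_ne_zero_of_natAbs_lt ht h10 (Or.inr hn)
  obtain ⟨h₁, h₂⟩ := exists_traversedBy_switchGraph_zigzag (t := t) (a := a) (b := b) (m := m)
    (k := k) (S := {y | ∃ r < m + 2 * k, y = zigzag m (a : ZMod t) r}) rfl rfl
    (by rcases hab with ⟨rfl, rfl⟩ | ⟨rfl, rfl⟩ <;> push_cast <;> ring)
    (by have := hnz (2 * a) (by omega); exact_mod_cast this)
    (by have := hnz (2 * b) (by omega); exact_mod_cast this)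
    (by have := hnz (a - b) (by omega); rwa [Int.cast_sub, sub_ne_zero] at this)
    hg hh hm hmg hL rfl
  set S : Set (ZMod t) := {y | ∃ r < m + 2 * k, y = zigzag m (a : ZMod t) r} with hS
  have h₃ : (∃ σ, TraversedBy (switchGraph (-3) 4 S) σ) ∧
      ∃ σ, TraversedBy (switchGraph 4 (-3) S) σ := by
    rcases hab with ⟨rfl, rfl⟩ | ⟨rfl, rfl⟩
    · push_cast at h₁ h₂
      exact ⟨h₂, h₁⟩
    · push_cast at h₁ h₂
      exact ⟨h₁, h₂⟩
  refine hasHamFactorization_pmSet_two_four_of_switchGraph ht h10 h₃.1 h₃.2 (x := (x : ZMod t)) ?_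
  intro j hj
  constructor
  · rintro ⟨r, hr, he⟩
    obtain ⟨n, hn, hn'⟩ := hT r hr
    refine intCast_ne_zero_of_natAbs_lt ht hc (hx j hj n hn).1 ?_
    push_cast
    rw [he, hn', sub_self]
  · rintro ⟨r, hr, he⟩
    obtain ⟨n, hn, hn'⟩ := hT r hr
    refine intCast_ne_zero_of_natAbs_lt ht hc (hx j hj n hn).2 ?_
    push_cast
    rw [he, hn', sub_self]

lemma zigzag_one_of_lt_three {p : ZMod t} {r : ℕ} (hr : r < 3) :
    zigzag 1 p r = 0 ∨ zigzag 1 p r = 2 * p - 1 ∨ zigzag 1 p r = 2 * p := by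
  interval_cases r
  · left; simp [zigzag]
  · right; left
    have := zigzag_add_even (m := 1) (p := p) 0
    simp at this
    rw [this]
    ring
  · right; right
    have := zigzag_add_odd (m := 1) (p := p) 0
    simp at this
    rw [this]

lemma hasHamFactorization_pmSet_two_four_of_ne_twelve [NeZero t] (ht : Even t) (h10 : 10 ≤ t)
    (h12 : t ≠ 12) : HasHamFactorization (pmSet t 2 4) := by
  have g3 : Int.gcd (-3) t = if t % 3 = 0 then 3 else 1 := by
    rw [Int.neg_gcd, show (3 : ℤ) = ((3 : ℕ) : ℤ) from rfl, Int.gcd_natCast_natCast,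
      Nat.gcd_rec]
    have := Nat.mod_lt t (show 3 > 0 by norm_num)
    interval_cases t % 3 <;> rfl
  have g4 : Int.gcd 4 t = if t % 4 = 0 then 4 else 2 := by
    rw [show (4 : ℤ) = ((4 : ℕ) : ℤ) from rfl, Int.gcd_natCast_natCast, Nat.gcd_rec]
    have := Nat.mod_lt t (show 4 > 0 by norm_num)
    have : t % 4 = 0 ∨ t % 4 = 2 := by rw [Nat.even_iff] at ht; omega
    rcases this with h | h <;> rw [h] <;> rfl
  by_cases h3 : t % 3 = 0 <;> by_cases h4 : t % 4 = 0
  · rw [if_pos h3] at g3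
    rw [if_pos h4] at g4
    refine hasHamFactorization_pmSet_two_four_of_zigzag (m := 3) (k := 0) (c := 24) ht h10
      (Or.inl ⟨rfl, rfl⟩) g3 g4 (by decide) (by decide) (by decide) {0, 1, 2} ?_ (-1) (by omega)
      (by decide)
    intro r hr
    rw [zigzag_of_lt hr]
    interval_cases r <;> simp
  · rw [if_pos h3] at g3
    rw [if_neg h4] at g4
    refine hasHamFactorization_pmSet_two_four_of_zigzag (m := 1) (k := 1) (c := 18) ht h10
      (Or.inr ⟨rfl, rfl⟩) g4 g3 (by decide) (by decide) (by decide) {0, 7, 8} ?_ 1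
      (by grind) (by decide)
    intro r hr
    rcases zigzag_one_of_lt_three (p := ((4 : ℤ) : ZMod t)) hr with h | h | h
    · exact ⟨0, by simp, by simpa using h⟩
    · exact ⟨7, by simp, by rw [h]; push_cast; ring⟩
    · exact ⟨8, by simp, by rw [h]; push_cast; ring⟩
  · rw [if_neg h3] at g3
    rw [if_pos h4] at g4
    refine hasHamFactorization_pmSet_two_four_of_zigzag (m := 1) (k := 1) (c := 16) ht h10
      (Or.inl ⟨rfl, rfl⟩) g3 g4 (by decide) (by decide) (by decide) {0, -7, -6} ?_ 5 (by omega)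
      (by decide)
    intro r hr
    rcases zigzag_one_of_lt_three (p := ((-3 : ℤ) : ZMod t)) hr with h | h | h
    · exact ⟨0, by simp, by simpa using h⟩
    · exact ⟨-7, by simp, by rw [h]; push_cast; ring⟩
    · exact ⟨-6, by simp, by rw [h]; push_cast; ring⟩
  · rw [if_neg h3] at g3
    rw [if_neg h4] at g4
    refine hasHamFactorization_pmSet_two_four_of_zigzag (m := 1) (k := 0) (c := 10) ht h10
      (Or.inl ⟨rfl, rfl⟩) g3 g4 (by decide) (by decide) (by decide) {0} ?_ (-1) h10 (by decide)
    intro r hr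
    obtain rfl : r = 0 := by omega
    exact ⟨0, by simp, by simp [zigzag]⟩

lemma hasHamFactorization_pmSet_two_four_twelve : HasHamFactorization (pmSet 12 2 4) := by
  refine ⟨Fin 3 × Bool, inferInstance, fun k =>
    if k.2 then ((![[0, 2, 4, 6, 8, 10, 1, 3, 5, 7, 11, 9], [0, 3, 6, 9, 1, 5, 8, 11, 2, 10, 7, 4],
      [0, 8, 4, 1, 11, 3, 7, 9, 5, 2, 6, 10]] : Fin 3 → List (ZMod 12)) k.1).formPerm else
      (((![[0, 2, 4, 6, 8, 10, 1, 3, 5, 7, 11, 9], [0, 3, 6, 9, 1, 5, 8, 11, 2, 10, 7, 4],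
      [0, 8, 4, 1, 11, 3, 7, 9, 5, 2, 6, 10]] : Fin 3 → List (ZMod 12)) k.1).reverse).formPerm,
      ?_, ?_, ?_⟩
  · rintro ⟨k, b⟩
    constructor
    · fin_cases k <;> rcases b with _ | _ <;> exact List.isCycle_formPerm (by decide) (by decide)
    · revert k b
      decide +kernel
  · decide +kernel
  · simp only [ExistsUnique]
    decide +kernel

end pmSetTwoFour

section

variable {t : ℕ} [NeZero t]

lemma hasHamFactorization_pmSet_two_four (ht : Even t) (h10 : 10 ≤ t) :
    HasHamFactorization (pmSet t 2 4) := by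
  by_cases h12 : t = 12
  · subst h12
    exact hasHamFactorization_pmSet_two_four_twelve
  · exact hasHamFactorization_pmSet_two_four_of_ne_twelve ht h10 h12

lemma hasHamFactorization_pmSet_self {d : ℕ} (hd : 1 ≤ d) (hdt : 2 * d < t)
    (h : d.Coprime t) : HasHamFactorization (pmSet t d d) := by
  have : Fact (1 < t) := ⟨by omega⟩
  have hu : IsUnit (d : ZMod t) := (ZMod.isUnit_iff_coprime d t).2 h
  have hne : (d : ZMod t) ≠ -d := by
    intro hh
    have h0 : ((2 * d : ℕ) : ZMod t) ≠ 0 := natCast_ne_zero_of_lt (by omega) hdt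
    push_cast at h0
    exact h0 (by linear_combination hh)
  have he : pmSet t d d = {(d : ZMod t)} ∪ {-(d : ZMod t)} := by
    simp [pmSet]
  rw [he]
  exact (hasHamFactorization_singleton hu).union (hasHamFactorization_singleton hu.neg)
    (Finset.disjoint_singleton.2 hne)

lemma hasHamFactorization_pmSet_one {n : ℕ} (ht : 2 * n < t) :
    HasHamFactorization (pmSet t 1 n) := by
  rcases Nat.even_or_odd' n with ⟨k, rfl | rfl⟩
  · exact hasHamFactorization_pmSet (n := k) le_rfl (by ring) ht
  · rw [← pmSet_union (b := 1) (by omega) (by omega)]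
    exact (hasHamFactorization_pmSet_self le_rfl (by omega) (Nat.coprime_one_left t)).union
      (hasHamFactorization_pmSet (n := k) (by omega) (by ring) ht) (pmSet_disjoint (by omega) ht)

lemma hasHamFactorization_pmSet_two {n : ℕ} (hn : 1 ≤ n) (ht : 2 * n < t)
    (h : Even t → n ≠ 2) : HasHamFactorization (pmSet t 2 n) := by
  rcases Nat.even_or_odd' n with ⟨k, rfl | rfl⟩
  · rcases Nat.even_or_odd t with he | ho
    · have : 2 * k ≠ 2 := h he
      rw [← pmSet_union (b := 4) (by omega) (by omega)]
      exact (hasHamFactorization_pmSet_two_four he (by grind)).union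
        (hasHamFactorization_pmSet (n := k - 2) (by omega) (by omega) ht)
        (pmSet_disjoint (by omega) ht)
    · rw [← pmSet_union (b := 2) (by omega) (by omega)]
      exact (hasHamFactorization_pmSet_self (by omega) (by omega)
        (Nat.coprime_two_left.2 ho)).union
        (hasHamFactorization_pmSet (n := k - 1) (by omega) (by omega) ht)
        (pmSet_disjoint (by omega) ht)
  · exact hasHamFactorization_pmSet (n := k) (by omega) (by ring) ht

end

end

/-- Lemma: for 2 ≤ s < t (with s ≠ 4 when t is even), the directed circulant
Circ(t; D) with D = {±1,…,±(s−1)/2} for odd s, and D = {−1} ∪ {±2,…,±(s/2)} for even s,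
admits a C_t-factorization. -/
theorem stmt15 (s t : ℕ) (hs : 2 ≤ s) (hst : s < t)
    (h4 : Even t → s ≠ 4) [NeZero t]
    (D : Finset (ZMod t))
    (hD : D = if s % 2 = 1 then pmSet t 1 ((s - 1) / 2)
              else insert (-1 : ZMod t) (pmSet t 2 (s / 2))) :
    CirculantHamFactorization t D := by
  subst hD
  apply HasHamFactorization.circulantHamFactorization
  split_ifs with hodd
  · exact hasHamFactorization_pmSet_one (by omega)
  · have : Fact (1 < t) := ⟨by omega⟩
    rw [Finset.insert_eq]
    refine (hasHamFactorization_singleton isUnit_one.neg).union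
      (hasHamFactorization_pmSet_two (by omega) (by omega) fun he => ?_) ?_
    · have := h4 he
      omega
    · refine Finset.disjoint_of_subset_left ?_
        (pmSet_disjoint (a := 1) (b := 1) (by omega) (by omega))
      simp [pmSet]
end

section
/- Let a, s, t be integers with 2 ≤ s < t, with s ≠ 3 if t is even, 0 ≤ a ≤ min{⌊s/3⌋, 2⌊t/2⌋ − s}, and a ≡ s (mod 2). Let S = {±(s+1)/2, ±(s+3)/2, …, ±⌊t/2⌋} (as residues modulo t) if s is odd, and S = {1} ∪ {±(s/2 + 1), ±(s/2 + 2), …, ±⌊t/2⌋} if s is even. Then Circ(t; S) admits an S-orthogonal (P_1^⟨a⟩, P_{t−s−a})-subdigraph. -/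
/-- The arcs of the directed path visiting the entries of `l` in order. -/
def pathArcs {α : Type*} (l : List α) : List (α × α) := l.zip l.tail

/-- An S-orthogonal subdigraph of Circ(t; S) that is a vertex-disjoint union of directed
paths, the i-th path having `lens[i]` arcs (a path with 0 arcs being a single vertex):
each path is a list of distinct vertices, the paths are pairwise vertex-disjoint, every
arc has its difference in S, and each difference in S is realized by exactly one arc. -/
def OrthogonalPaths (t : ℕ) (S : Finset (ZMod t)) (lens : List ℕ) : Prop :=
  ∃ vs : List (List (ZMod t)),
    vs.length = lens.length ∧
    (∀ p ∈ vs, p.Nodup) ∧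
    List.Pairwise (fun p q => ∀ x ∈ p, x ∉ q) vs ∧
    (∀ i, i < lens.length → (vs.getD i []).length = lens.getD i 0 + 1) ∧
    (∀ a ∈ (vs.map pathArcs).flatten, a.2 - a.1 ∈ S) ∧
    (∀ d ∈ S,
      (((vs.map pathArcs).flatten).filter fun a => a.2 - a.1 = d).length = 1)

/-- `v` is reached from `u` by a step of length `ρ` around a cycle of length `t`. -/
def StepMod (t ρ u v : ℕ) : Prop := v = u + ρ ∨ v + t = u + ρ

theorem StepMod.cast_sub {t ρ u v : ℕ} (h : StepMod t ρ u v) :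
    (v : ZMod t) - (u : ZMod t) = (ρ : ZMod t) := by
  rcases h with h | h
  · subst h; push_cast; ring
  · have := congrArg (Nat.cast : ℕ → ZMod t) h
    push_cast at this
    rw [ZMod.natCast_self, add_zero] at this
    rw [this]; ring

theorem natCast_zmod_injOn {t u v : ℕ} (hu : u < t) (hv : v < t)
    (h : (u : ZMod t) = (v : ZMod t)) : u = v := by
  rw [ZMod.natCast_eq_natCast_iff'] at h
  rwa [Nat.mod_eq_of_lt hu, Nat.mod_eq_of_lt hv] at h

theorem length_pathArcs {α : Type*} (l : List α) : (pathArcs l).length = l.length - 1 := by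
  simp [pathArcs]

theorem mem_pathArcs_map_range {α : Type*} (f : ℕ → α) {i n : ℕ} (hi : i < n) :
    (f i, f (i + 1)) ∈ pathArcs ((List.range (n + 1)).map f) := by
  rw [List.mem_iff_getElem]
  refine ⟨i, by simp [pathArcs]; omega, ?_⟩
  simp [pathArcs]

theorem pmSet_eq_image {t k : ℕ} (hk : 1 ≤ k) (ht : 0 < t) :
    pmSet t k (t / 2) = (Finset.Icc k (t - k)).image (fun j : ℕ => (j : ZMod t)) := by
  ext d
  simp only [pmSet, Finset.mem_union, Finset.mem_image, Finset.mem_Icc]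
  constructor
  · rintro (⟨j, hj, rfl⟩ | ⟨j, hj, rfl⟩)
    · exact ⟨j, by omega, rfl⟩
    · refine ⟨t - j, by omega, ?_⟩
      rw [Nat.cast_sub (by omega), ZMod.natCast_self, zero_sub]
  · rintro ⟨j, hj, rfl⟩
    by_cases h : j ≤ t / 2
    · exact Or.inl ⟨j, by omega, rfl⟩
    · refine Or.inr ⟨t - j, by omega, ?_⟩
      rw [Nat.cast_sub (by omega), ZMod.natCast_self]
      ring

/-- A family of steps using as many arcs as there are prescribed residues and covering each
of them gives orthogonal paths. -/
theorem orthogonalPaths_of_steps {t a n : ℕ} {T : Finset ℕ} (x y p : ℕ → ℕ)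
    (hT : ∀ ρ ∈ T, ρ < t) (hcard : T.card = a + n)
    (hx : ∀ i < a, x i < t) (hy : ∀ i < a, y i < t) (hp : ∀ i ≤ n, p i < t)
    (hxx : ∀ i < a, ∀ j < a, x i = x j → i = j)
    (hyy : ∀ i < a, ∀ j < a, y i = y j → i = j)
    (hpp : ∀ i ≤ n, ∀ j ≤ n, p i = p j → i = j)
    (hxy : ∀ i < a, ∀ j < a, x i ≠ y j)
    (hxp : ∀ i < a, ∀ j ≤ n, x i ≠ p j)
    (hyp : ∀ i < a, ∀ j ≤ n, y i ≠ p j)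
    (hs : ∀ ρ ∈ T, (∃ i < a, StepMod t ρ (x i) (y i)) ∨
      ∃ i < n, StepMod t ρ (p i) (p (i + 1))) :
    OrthogonalPaths t (T.image (fun j : ℕ => (j : ZMod t))) (List.replicate a 1 ++ [n]) := by
  classical
  set vs : List (List (ZMod t)) :=
    (List.range a).map (fun i => [(x i : ZMod t), (y i : ZMod t)]) ++
      [(List.range (n + 1)).map (fun i => (p i : ZMod t))] with hvs
  set D : List (ZMod t) := ((vs.map pathArcs).flatten).map (fun b => b.2 - b.1) with hD
  set S : Finset (ZMod t) := T.image (fun j : ℕ => (j : ZMod t)) with hS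
  have hDlen : D.length = a + n := by
    simp only [hD, hvs, List.length_map, List.length_flatten, List.map_append, List.map_map,
      List.sum_append]
    congr 1
    · have : (List.length ∘ pathArcs ∘ fun i => [(x i : ZMod t), (y i : ZMod t)])
          = fun _ => 1 := by
        funext i; simp [length_pathArcs]
      rw [this]; simp
    · simp [length_pathArcs]
  have hScard : S.card = a + n := by
    rw [← hcard]
    exact Finset.card_image_of_injOn fun u hu v hv h => natCast_zmod_injOn (hT u hu) (hT v hv) h
  have hsub : S ⊆ D.toFinset := by
    intro d hd
    rw [hS, Finset.mem_image] at hd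
    obtain ⟨ρ, hρ, rfl⟩ := hd
    rw [List.mem_toFinset, hD, List.mem_map]
    rcases hs ρ hρ with ⟨i, hi, h⟩ | ⟨i, hi, h⟩
    · refine ⟨((x i : ZMod t), (y i : ZMod t)), ?_, h.cast_sub⟩
      rw [List.mem_flatten]
      refine ⟨pathArcs [(x i : ZMod t), (y i : ZMod t)], ?_, by simp [pathArcs]⟩
      exact List.mem_map_of_mem (List.mem_append_left _
        (List.mem_map_of_mem (f := fun i => [(x i : ZMod t), (y i : ZMod t)])
          (List.mem_range.2 hi)))
    · refine ⟨((p i : ZMod t), (p (i + 1) : ZMod t)), ?_, h.cast_sub⟩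
      rw [List.mem_flatten]
      exact ⟨_, List.mem_map_of_mem (List.mem_append_right _ (List.mem_singleton_self _)),
        mem_pathArcs_map_range (fun i => (p i : ZMod t)) hi⟩
  have hDS : S = D.toFinset :=
    Finset.eq_of_subset_of_card_le hsub
      (by rw [hScard, ← hDlen]; exact List.toFinset_card_le D)
  have hDnd : D.Nodup := by
    rw [← Multiset.coe_nodup, ← Multiset.toFinset_card_eq_card_iff_nodup]
    change D.toFinset.card = D.length
    rw [← hDS, hScard, hDlen]
  refine ⟨vs, by simp [hvs], ?_, ?_, ?_, ?_, ?_⟩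
  · intro q hq
    rw [hvs, List.mem_append, List.mem_map, List.mem_singleton] at hq
    rcases hq with ⟨i, hi, rfl⟩ | rfl
    · rw [List.mem_range] at hi
      have : (x i : ZMod t) ≠ (y i : ZMod t) := fun h =>
        hxy i hi i hi (natCast_zmod_injOn (hx i hi) (hy i hi) h)
      simpa using this
    · refine List.Nodup.map_on ?_ List.nodup_range
      intro i hi j hj h
      rw [List.mem_range] at hi hj
      exact hpp i (by omega) j (by omega)
        (natCast_zmod_injOn (hp i (by omega)) (hp j (by omega)) h)
  · rw [hvs, List.pairwise_append]
    refine ⟨?_, by simp, ?_⟩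
    · rw [List.pairwise_map]
      refine List.Pairwise.imp_of_mem ?_ (List.nodup_range (n := a))
      intro i j hi hj hij v hv hv'
      rw [List.mem_range] at hi hj
      simp only [List.mem_cons, List.not_mem_nil, or_false] at hv hv'
      rcases hv with rfl | rfl <;> rcases hv' with h | h
      · exact hij (hxx i hi j hj (natCast_zmod_injOn (hx i hi) (hx j hj) h))
      · exact hxy i hi j hj (natCast_zmod_injOn (hx i hi) (hy j hj) h)
      · exact hxy j hj i hi (natCast_zmod_injOn (hx j hj) (hy i hi) h.symm)
      · exact hij (hyy i hi j hj (natCast_zmod_injOn (hy i hi) (hy j hj) h))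
    · intro q hq q' hq' v hv hv'
      rw [List.mem_map] at hq
      obtain ⟨i, hi, rfl⟩ := hq
      rw [List.mem_singleton] at hq'
      subst hq'
      rw [List.mem_map] at hv'
      obtain ⟨j, hj, rfl⟩ := hv'
      rw [List.mem_range] at hi hj
      simp only [List.mem_cons, List.not_mem_nil, or_false] at hv
      rcases hv with h | h
      · exact hxp i hi j (by omega)
          (natCast_zmod_injOn (hx i hi) (hp j (by omega)) h.symm)
      · exact hyp i hi j (by omega)
          (natCast_zmod_injOn (hy i hi) (hp j (by omega)) h.symm)
  · intro i hi
    rw [List.length_append, List.length_replicate, List.length_singleton] at hi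
    by_cases h : i < a
    · rw [hvs, List.getD_append _ _ _ _ (by simpa using h),
        List.getD_append _ _ _ _ (by simpa using h)]
      simp [List.getD_eq_getElem?_getD, h]
    · have : i = a := by omega
      subst this
      rw [hvs, List.getD_append_right _ _ _ _ (by simp),
        List.getD_append_right _ _ _ _ (by simp)]
      simp
  · intro b hb
    rw [hDS, List.mem_toFinset, hD]
    exact List.mem_map_of_mem (f := fun b : ZMod t × ZMod t => b.2 - b.1) hb
  · intro d hd
    have hmem : d ∈ D := by rw [hDS, List.mem_toFinset] at hd; exact hd
    have hcount := List.count_eq_one_of_mem hDnd hmem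
    rw [hD, List.count_eq_countP, List.countP_map, List.countP_eq_length_filter] at hcount
    rw [← hcount]
    congr 1

/-- The `j`-th vertex of the left arm of a zigzag with `r` vertices on each arm, where `b`
vertices are left out in the middle of the left arm. -/
def zigLeft (r b j : ℕ) : ℕ := if j < (r + 1) / 2 then j else j + b

/-- The `j`-th vertex, counted downwards from `h`, of the right arm of a zigzag with `r`
vertices on each arm, where `b` vertices are left out in the middle of the right arm. -/
def zigRight (h r b j : ℕ) : ℕ := if j < r / 2 then h - j else h - j - b

/-- The `i`-th vertex of the path alternating between the two arms, preceded by `v` if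
`e = 1`. -/
def zigPath (h r b c e v i : ℕ) : ℕ :=
  if i < e then v
  else if (i - e) % 2 = 0 then zigLeft r b ((i - e) / 2) else zigRight h r c ((i - e) / 2)

/-- `v` lies in one of the two gaps between the arms of a zigzag. -/
def InZigGap (t k r b v : ℕ) : Prop :=
  (r + b ≤ v ∧ v + 1 < r + b + k) ∨ (t + 1 ≤ v + k ∧ v < t)

/-- The residue `ρ` is the length of a step of a zigzag. -/
def ZigCovers (t k r b c ρ : ℕ) : Prop :=
  (∃ j < r, zigRight (t - k) r c j = zigLeft r b j + ρ) ∨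
    ∃ j, j + 1 < r ∧ zigLeft r b (j + 1) + t = zigRight (t - k) r c j + ρ

section zigzag

variable {t k r b c : ℕ}

theorem zigPath_lt_and_not_gap (ht : t + 2 = 2 * r + 2 * k + b + c) (hk : 1 ≤ k)
    {e v i : ℕ} (hi : e ≤ i) (hi' : i < 2 * r + e) :
    zigPath (t - k) r b c e v i < t ∧ ¬ InZigGap t k r b (zigPath (t - k) r b c e v i) := by
  unfold zigPath zigLeft zigRight InZigGap
  split_ifs <;> omega

theorem zigPath_injective (ht : t + 2 = 2 * r + 2 * k + b + c) (hk : 1 ≤ k)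
    {e v i j : ℕ} (hi : e ≤ i) (hi' : i < 2 * r + e) (hj : e ≤ j) (hj' : j < 2 * r + e)
    (h : zigPath (t - k) r b c e v i = zigPath (t - k) r b c e v j) : i = j := by
  unfold zigPath zigLeft zigRight at h
  split_ifs at h <;> omega

theorem zigPath_even (h r b c e v j : ℕ) :
    zigPath h r b c e v (2 * j + e) = zigLeft r b j := by
  rw [zigPath, if_neg (by omega), if_pos (by omega), show (2 * j + e - e) / 2 = j by omega]

theorem zigPath_odd (h r b c e v j : ℕ) :
    zigPath h r b c e v (2 * j + 1 + e) = zigRight h r c j := by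
  rw [zigPath, if_neg (by omega), if_neg (by omega),
    show (2 * j + 1 + e - e) / 2 = j by omega]

theorem orthogonalPaths_of_zigzag {a e v : ℕ} {T : Finset ℕ} (x y : ℕ → ℕ)
    (ht : t + 2 = 2 * r + 2 * k + b + c) (hk : 1 ≤ k) (hr : 1 ≤ r) (he : e ≤ 1)
    (hT : ∀ ρ ∈ T, ρ < t) (hcard : T.card = a + (2 * r - 1 + e))
    (hv : e = 1 → InZigGap t k r b v)
    (hx : ∀ i < a, InZigGap t k r b (x i) ∧ (e = 1 → x i ≠ v))
    (hy : ∀ i < a, InZigGap t k r b (y i) ∧ (e = 1 → y i ≠ v))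
    (hxx : ∀ i < a, ∀ j < a, x i = x j → i = j)
    (hyy : ∀ i < a, ∀ j < a, y i = y j → i = j)
    (hxy : ∀ i < a, ∀ j < a, x i ≠ y j)
    (hs : ∀ ρ ∈ T, (∃ i < a, StepMod t ρ (x i) (y i)) ∨ (e = 1 ∧ StepMod t ρ v 0) ∨
      ZigCovers t k r b c ρ) :
    OrthogonalPaths t (T.image (fun j : ℕ => (j : ZMod t)))
      (List.replicate a 1 ++ [2 * r - 1 + e]) := by
  have hgap : ∀ u, InZigGap t k r b u → u < t := by
    intro u hu; unfold InZigGap at hu; omega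
  have hne : ∀ u, InZigGap t k r b u → (e = 1 → u ≠ v) → ∀ j ≤ 2 * r - 1 + e,
      u ≠ zigPath (t - k) r b c e v j := by
    intro u hu huv j hj h
    by_cases hje : j < e
    · exact huv (by omega) (by rw [h, zigPath, if_pos hje])
    · exact (zigPath_lt_and_not_gap ht hk (by omega) (by omega)).2 (h ▸ hu)
  refine orthogonalPaths_of_steps x y (zigPath (t - k) r b c e v) hT hcard
    (fun i hi => hgap _ (hx i hi).1) (fun i hi => hgap _ (hy i hi).1) ?_ hxx hyy ?_ hxy
    (fun i hi => hne _ (hx i hi).1 (hx i hi).2) (fun i hi => hne _ (hy i hi).1 (hy i hi).2) ?_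
  · intro i hi
    by_cases hie : i < e
    · rw [zigPath, if_pos hie]; exact hgap v (hv (by omega))
    · exact (zigPath_lt_and_not_gap ht hk (by omega) (by omega)).1
  · have hpre : ∀ i < e, ∀ j, e ≤ j → j ≤ 2 * r - 1 + e →
        zigPath (t - k) r b c e v i ≠ zigPath (t - k) r b c e v j := by
      intro i hi j hj hj' h
      refine (zigPath_lt_and_not_gap (v := v) ht hk hj (by omega)).2 (h ▸ ?_)
      rw [zigPath, if_pos hi]; exact hv (by omega)
    intro i hi j hj h
    by_cases hie : i < e <;> by_cases hje : j < e
    · omega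
    · exact absurd h (hpre i hie j (by omega) hj)
    · exact absurd h.symm (hpre j hje i (by omega) hi)
    · exact zigPath_injective ht hk (by omega) (by omega) (by omega) (by omega) h
  · intro ρ hρ
    rcases hs ρ hρ with h | ⟨h1, h⟩ | ⟨j, hj, h⟩ | ⟨j, hj, h⟩
    · exact Or.inl h
    · refine Or.inr ⟨0, by omega, ?_⟩
      subst h1
      have h0 : zigLeft r b 0 = 0 := by rw [zigLeft, if_pos (by omega)]
      simpa [zigPath, h0] using h
    · refine Or.inr ⟨2 * j + e, by omega, Or.inl ?_⟩
      rw [zigPath_even, show 2 * j + e + 1 = 2 * j + 1 + e by omega, zigPath_odd, h]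
    · refine Or.inr ⟨2 * j + 1 + e, by omega, Or.inr ?_⟩
      rw [zigPath_odd, show 2 * j + 1 + e + 1 = 2 * (j + 1) + e by omega, zigPath_even, h]

end zigzag

section cover

variable {t k r b c ρ : ℕ}

theorem zigCovers_of_up {j : ℕ} (ht : t + 2 = 2 * r + 2 * k + b + c) (hk : 1 ≤ k)
    (hj : j < r) (h : (j < r / 2 ∧ ρ + k + 2 * j = t) ∨
      (r / 2 ≤ j ∧ j < (r + 1) / 2 ∧ ρ + k + 2 * j + c = t) ∨
      ((r + 1) / 2 ≤ j ∧ ρ + k + 2 * j + b + c = t)) :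
    ZigCovers t k r b c ρ := by
  refine Or.inl ⟨j, hj, ?_⟩
  unfold zigRight zigLeft
  split_ifs <;> omega

theorem zigCovers_of_down {j : ℕ} (ht : t + 2 = 2 * r + 2 * k + b + c) (hk : 1 ≤ k)
    (hj : j + 1 < r) (h : (j < r / 2 ∧ j + 1 < (r + 1) / 2 ∧ ρ = k + 2 * j + 1) ∨
      (j < r / 2 ∧ (r + 1) / 2 ≤ j + 1 ∧ ρ = k + 2 * j + 1 + b) ∨
      (r / 2 ≤ j ∧ ρ = k + 2 * j + 1 + b + c)) :
    ZigCovers t k r b c ρ := by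
  refine Or.inr ⟨j, hj, ?_⟩
  unfold zigRight zigLeft
  split_ifs <;> omega

theorem zigCovers_left_odd {m : ℕ} (ht : t + 1 = 2 * r + 2 * k + 2 * m) (hk : 1 ≤ k)
    (hkρ : k ≤ ρ) (hρk : ρ + k ≤ t) (h : ρ + 1 < r + k ∨ r + k + 2 * m ≤ ρ) :
    ZigCovers t k r (2 * m + 1) 0 ρ := by
  by_cases hp : (ρ + k) % 2 = 0
  · rcases h with h | h
    · exact zigCovers_of_up (j := (2 * r + k - 2 - ρ) / 2) (by omega) hk (by omega) (by omega)
    · exact zigCovers_of_down (j := (ρ - k - 2 * m - 2) / 2) (by omega) hk (by omega) (by omega)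
  · rcases h with h | h
    · exact zigCovers_of_down (j := (ρ - k) / 2) (by omega) hk (by omega) (by omega)
    · exact zigCovers_of_up (j := (t - k - ρ) / 2) (by omega) hk (by omega) (by omega)

theorem zigCovers_right_even {m : ℕ} (ht : t + 2 = 2 * r + 2 * k + 2 * m) (hk : 1 ≤ k)
    (hkρ : k ≤ ρ) (hρk : ρ + k ≤ t) (h : ρ < r + k ∨ r + k + 2 * m ≤ ρ) :
    ZigCovers t k r 0 (2 * m) ρ := by
  by_cases hp : (ρ + k) % 2 = 0
  · rcases h with h | h
    · exact zigCovers_of_up (j := (2 * r + k - 2 - ρ) / 2) (by omega) hk (by omega) (by omega)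
    · exact zigCovers_of_up (j := (t - k - ρ) / 2) (by omega) hk (by omega) (by omega)
  · rcases h with h | h
    · exact zigCovers_of_down (j := (ρ - k) / 2) (by omega) hk (by omega) (by omega)
    · exact zigCovers_of_down (j := (ρ - k - 2 * m) / 2) (by omega) hk (by omega) (by omega)

theorem zigCovers_left_two (ht : t = 2 * r + 2 * k) (hk : 1 ≤ k)
    (hkρ : k ≤ ρ) (hρk : ρ + k ≤ t) (h : ρ + 1 < r + k ∨ r + k + 1 ≤ ρ) :
    ZigCovers t k r 2 0 ρ := by
  by_cases hp : (ρ + k) % 2 = 0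
  · rcases h with h | h
    · exact zigCovers_of_up (j := (2 * r + k - 2 - ρ) / 2) (by omega) hk (by omega) (by omega)
    · exact zigCovers_of_up (j := (t - k - ρ) / 2) (by omega) hk (by omega) (by omega)
  · rcases h with h | h
    · exact zigCovers_of_down (j := (ρ - k) / 2) (by omega) hk (by omega) (by omega)
    · exact zigCovers_of_down (j := (ρ - k - 2) / 2) (by omega) hk (by omega) (by omega)

theorem zigCovers_left_odd_right_one {m : ℕ} (ht : t = 2 * r + 2 * k + 2 * m) (hk : 1 ≤ k)
    (hr : 1 ≤ r) (hkρ : k ≤ ρ) (hρk : ρ + k ≤ t)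
    (h : ρ + 1 < r + k ∨ r + k + 2 * m + 1 < ρ ∨ ρ = r + k + 2 * m) :
    ZigCovers t k r (2 * m + 1) 1 ρ := by
  rcases h with h | h | h
  · by_cases hp : (ρ + k) % 2 = 0
    · exact zigCovers_of_up (j := (2 * r + k - 2 - ρ) / 2) (by omega) hk (by omega) (by omega)
    · exact zigCovers_of_down (j := (ρ - k) / 2) (by omega) hk (by omega) (by omega)
  · by_cases hp : (ρ + k) % 2 = 0
    · exact zigCovers_of_up (j := (t - k - ρ) / 2) (by omega) hk (by omega) (by omega)
    · exact zigCovers_of_down (j := (ρ - k - 2 * m - 2) / 2) (by omega) hk (by omega) (by omega)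
  · by_cases hp : r % 2 = 0
    · exact zigCovers_of_down (j := r / 2 - 1) (by omega) hk (by omega) (by omega)
    · exact zigCovers_of_up (j := r / 2) (by omega) hk (by omega) (by omega)

end cover

/-- First coordinate of a matching between two intervals realizing the differences
`0, …, n - 1`. -/
def matchFst (n i : ℕ) : ℕ := if i % 2 = 0 then (n - 1 - i) / 2 else (2 * n - 1 - i) / 2

/-- Second coordinate of a matching between two intervals realizing the differences
`0, …, n - 1`. -/
def matchSnd (n i : ℕ) : ℕ := if i % 2 = 0 then (n - 1 + i) / 2 else (2 * n - 1 + i) / 2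

section matching

variable {n i j : ℕ}

theorem matchSnd_eq (hi : i < n) : matchSnd n i = matchFst n i + i := by
  unfold matchSnd matchFst
  split_ifs <;> omega

theorem matchFst_lt (hi : i < n) : matchFst n i < n := by
  unfold matchFst
  split_ifs <;> omega

theorem matchSnd_le (hi : i < n) : 2 * matchSnd n i + 2 ≤ 3 * n := by
  unfold matchSnd
  split_ifs <;> omega

theorem matchFst_injective (hi : i < n) (hj : j < n)
    (h : matchFst n i = matchFst n j) : i = j := by
  unfold matchFst at h
  split_ifs at h <;> omega

theorem matchSnd_injective (hi : i < n) (hj : j < n)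
    (h : matchSnd n i = matchSnd n j) : i = j := by
  unfold matchSnd at h
  split_ifs at h <;> omega

end matching

theorem orthogonalPaths_odd_odd {t k r m : ℕ} (ht : t + 1 = 2 * r + 2 * k + 2 * m)
    (hr : 1 ≤ r) (hk : 3 * m + 2 ≤ k) :
    OrthogonalPaths t ((Finset.Icc k (t - k)).image (fun j : ℕ => (j : ZMod t)))
      (List.replicate (2 * m + 1) 1 ++ [2 * r - 1]) := by
  refine orthogonalPaths_of_zigzag (k := k) (r := r) (b := 2 * m + 1) (c := 0) (e := 0) (v := 0)
    (fun i => r + (2 * m + 1) + matchFst (2 * m + 1) i)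
    (fun i => t + 1 - k + matchSnd (2 * m + 1) i)
    (by omega) (by omega) hr (by omega) ?_ ?_ (by omega) ?_ ?_ ?_ ?_ ?_ ?_
  · intro ρ hρ; rw [Finset.mem_Icc] at hρ; omega
  · rw [Nat.card_Icc]; omega
  · intro i hi
    have := matchFst_lt (n := 2 * m + 1) (i := i) (by omega)
    exact ⟨Or.inl (by omega), by omega⟩
  · intro i hi
    have := matchSnd_le (n := 2 * m + 1) (i := i) (by omega)
    exact ⟨Or.inr (by omega), by omega⟩
  · intro i hi j hj h
    exact matchFst_injective (n := 2 * m + 1) (by omega) (by omega) (by omega)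
  · intro i hi j hj h
    exact matchSnd_injective (n := 2 * m + 1) (by omega) (by omega) (by omega)
  · intro i hi j hj
    have := matchFst_lt (n := 2 * m + 1) (i := i) (by omega)
    have := matchSnd_le (n := 2 * m + 1) (i := j) (by omega)
    omega
  · intro ρ hρ
    rw [Finset.mem_Icc] at hρ
    by_cases h : ρ + 1 < r + k ∨ r + k + 2 * m ≤ ρ
    · exact Or.inr (Or.inr (zigCovers_left_odd ht (by omega) hρ.1 (by omega) h))
    · refine Or.inl ⟨ρ + 1 - (r + k), by omega, Or.inl ?_⟩
      have := matchSnd_eq (n := 2 * m + 1) (i := ρ + 1 - (r + k)) (by omega)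
      omega

theorem orthogonalPaths_odd_even {t k r m : ℕ} (ht : t + 1 = 2 * r + 2 * k + 2 * m)
    (hr : 1 ≤ r) (hk : 3 * m + 4 ≤ k) :
    OrthogonalPaths t ((insert 1 (Finset.Icc k (t - k))).image (fun j : ℕ => (j : ZMod t)))
      (List.replicate (2 * m + 2) 1 ++ [2 * r - 1]) := by
  refine orthogonalPaths_of_zigzag (k := k) (r := r) (b := 2 * m + 1) (c := 0) (e := 0) (v := 0)
    (fun i => if i < 2 * m + 1 then r + (2 * m + 1) + matchFst (2 * m + 1) i
      else r + (2 * m + 1) + (2 * m + 1))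
    (fun i => if i < 2 * m + 1 then t + 1 - k + matchSnd (2 * m + 1) i
      else r + (2 * m + 1) + (2 * m + 2))
    (by omega) (by omega) hr (by omega) ?_ ?_ (by omega) ?_ ?_ ?_ ?_ ?_ ?_
  · intro ρ hρ; rw [Finset.mem_insert, Finset.mem_Icc] at hρ; omega
  · rw [Finset.card_insert_of_notMem (by rw [Finset.mem_Icc]; omega), Nat.card_Icc]; omega
  · intro i hi
    refine ⟨Or.inl ?_, by omega⟩
    split_ifs with h
    · have := matchFst_lt h
      omega
    · omega
  · intro i hi
    refine ⟨?_, by omega⟩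
    split_ifs with h
    · have := matchSnd_le h
      exact Or.inr (by omega)
    · exact Or.inl (by omega)
  · intro i hi j hj h
    split_ifs at h with h1 h2 h2
    · exact matchFst_injective h1 h2 (by omega)
    · have := matchFst_lt h1
      omega
    · have := matchFst_lt h2
      omega
    · omega
  · intro i hi j hj h
    split_ifs at h with h1 h2 h2
    · exact matchSnd_injective h1 h2 (by omega)
    · omega
    · omega
    · omega
  · intro i hi j hj
    split_ifs with h1 h2 h2
    · have := matchFst_lt h1
      omega
    · have := matchFst_lt h1
      omega
    · omega
    · omega
  · intro ρ hρ
    rw [Finset.mem_insert, Finset.mem_Icc] at hρ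
    rcases hρ with rfl | hρ
    · refine Or.inl ⟨2 * m + 1, by omega, Or.inl ?_⟩
      rw [if_neg (by omega), if_neg (by omega)]
      omega
    by_cases h : ρ + 1 < r + k ∨ r + k + 2 * m ≤ ρ
    · exact Or.inr (Or.inr (zigCovers_left_odd ht (by omega) hρ.1 (by omega) h))
    · refine Or.inl ⟨ρ + 1 - (r + k), by omega, Or.inl ?_⟩
      have := matchSnd_eq (n := 2 * m + 1) (i := ρ + 1 - (r + k)) (by omega)
      rw [if_pos (by omega), if_pos (by omega)]
      omega

theorem orthogonalPaths_even_even {t k r m : ℕ} (ht : t + 2 = 2 * r + 2 * k + 2 * m)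
    (hr : 1 ≤ r) (hk : 2 ≤ k) (hmk : 3 * m + 1 ≤ k) :
    OrthogonalPaths t ((insert 1 (Finset.Icc k (t - k))).image (fun j : ℕ => (j : ZMod t)))
      (List.replicate (2 * m) 1 ++ [2 * r - 1 + 1]) := by
  refine orthogonalPaths_of_zigzag (k := k) (r := r) (b := 0) (c := 2 * m) (e := 1) (v := t - 1)
    (fun i => r + matchSnd (2 * m) i) (fun i => t + 1 - k + matchFst (2 * m) i)
    (by omega) (by omega) hr (by omega) ?_ ?_ (fun _ => Or.inr (by omega)) ?_ ?_ ?_ ?_ ?_ ?_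
  · intro ρ hρ; rw [Finset.mem_insert, Finset.mem_Icc] at hρ; omega
  · rw [Finset.card_insert_of_notMem (by rw [Finset.mem_Icc]; omega), Nat.card_Icc]; omega
  · intro i hi
    have := matchSnd_le hi
    exact ⟨Or.inl (by omega), by omega⟩
  · intro i hi
    have := matchFst_lt hi
    exact ⟨Or.inr (by omega), by omega⟩
  · intro i hi j hj h
    exact matchSnd_injective hi hj (by omega)
  · intro i hi j hj h
    exact matchFst_injective hi hj (by omega)
  · intro i hi j hj
    have := matchSnd_le hi
    have := matchFst_lt hj
    omega
  · intro ρ hρ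
    rw [Finset.mem_insert, Finset.mem_Icc] at hρ
    rcases hρ with rfl | hρ
    · exact Or.inr (Or.inl ⟨rfl, Or.inr (by omega)⟩)
    by_cases h : ρ < r + k ∨ r + k + 2 * m ≤ ρ
    · exact Or.inr (Or.inr (zigCovers_right_even ht (by omega) hρ.1 (by omega) h))
    · refine Or.inl ⟨r + k + 2 * m - 1 - ρ, by omega, Or.inl ?_⟩
      have := matchSnd_eq (n := 2 * m) (i := r + k + 2 * m - 1 - ρ) (by omega)
      omega

theorem orthogonalPaths_even_even_point {t k m : ℕ} (ht : t + 2 = 2 * k + 2 * m)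
    (hm : 1 ≤ m) (hmk : 3 * m + 1 ≤ k) :
    OrthogonalPaths t ((insert 1 (Finset.Icc k (t - k))).image (fun j : ℕ => (j : ZMod t)))
      (List.replicate (2 * m) 1 ++ [0]) := by
  refine orthogonalPaths_of_steps
    (fun i => if i = 0 then t - 1 else matchSnd (2 * m) i)
    (fun i => if i = 0 then 0 else t + 1 - k + matchFst (2 * m) i)
    (fun _ => t + 1 - k + matchFst (2 * m) 0) ?_ ?_ ?_ ?_ ?_ ?_ ?_ ?_ ?_ ?_ ?_ ?_
  · intro ρ hρ; rw [Finset.mem_insert, Finset.mem_Icc] at hρ; omega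
  · rw [Finset.card_insert_of_notMem (by rw [Finset.mem_Icc]; omega), Nat.card_Icc]; omega
  · intro i hi
    have := matchSnd_le hi
    split_ifs <;> omega
  · intro i hi
    have := matchFst_lt hi
    split_ifs <;> omega
  · intro i _
    have := matchFst_lt (n := 2 * m) (i := 0) (by omega)
    omega
  · intro i hi j hj h
    have := matchSnd_le hi
    have := matchSnd_le hj
    split_ifs at h
    · omega
    · omega
    · omega
    · exact matchSnd_injective hi hj h
  · intro i hi j hj h
    split_ifs at h
    · omega
    · omega
    · omega
    · exact matchFst_injective hi hj (by omega)
  · intros; omega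
  · intro i hi j hj
    have := matchSnd_le hi
    have := matchSnd_eq hi
    have := matchFst_lt hj
    split_ifs <;> omega
  · intro i hi j hj
    have := matchSnd_le hi
    have := matchFst_lt (n := 2 * m) (i := 0) (by omega)
    split_ifs <;> omega
  · intro i hi j hj h
    split_ifs at h with h0
    · omega
    · exact h0 (matchFst_injective hi (by omega) (by omega))
  · intro ρ hρ
    rw [Finset.mem_insert, Finset.mem_Icc] at hρ
    rcases hρ with rfl | hρ
    · exact Or.inl ⟨0, by omega, Or.inr (by rw [if_pos rfl, if_pos rfl]; omega)⟩
    · refine Or.inl ⟨k + 2 * m - 1 - ρ, by omega, Or.inl ?_⟩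
      have := matchSnd_eq (n := 2 * m) (i := k + 2 * m - 1 - ρ) (by omega)
      rw [if_neg (by omega), if_neg (by omega)]
      omega

theorem orthogonalPaths_even_odd_point {t k m : ℕ} (ht : t = 2 * k + 2 * m)
    (hmk : 3 * m + 2 ≤ k) :
    OrthogonalPaths t ((Finset.Icc k (t - k)).image (fun j : ℕ => (j : ZMod t)))
      (List.replicate (2 * m + 1) 1 ++ [0]) := by
  refine orthogonalPaths_of_steps
    (fun i => matchFst (2 * m + 1) i) (fun i => k + matchSnd (2 * m + 1) i)
    (fun _ => 2 * m + 1) ?_ ?_ ?_ ?_ ?_ ?_ ?_ ?_ ?_ ?_ ?_ ?_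
  · intro ρ hρ; rw [Finset.mem_Icc] at hρ; omega
  · rw [Nat.card_Icc]; omega
  · intro i hi
    have := matchFst_lt hi
    omega
  · intro i hi
    have := matchSnd_le hi
    omega
  · intro i _
    omega
  · intro i hi j hj h
    exact matchFst_injective hi hj h
  · intro i hi j hj h
    exact matchSnd_injective hi hj (by omega)
  · intros; omega
  · intro i hi j hj
    have := matchFst_lt hi
    omega
  · intro i hi j hj
    have := matchFst_lt hi
    omega
  · intro i hi j hj
    omega
  · intro ρ hρ
    rw [Finset.mem_Icc] at hρ
    refine Or.inl ⟨ρ - k, by omega, Or.inl ?_⟩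
    have := matchSnd_eq (n := 2 * m + 1) (i := ρ - k) (by omega)
    omega

theorem orthogonalPaths_even_odd_one {t k r : ℕ} (ht : t = 2 * r + 2 * k)
    (hr : 1 ≤ r) (hk : 3 ≤ k) :
    OrthogonalPaths t ((Finset.Icc k (t - k)).image (fun j : ℕ => (j : ZMod t)))
      (List.replicate 1 1 ++ [2 * r - 1 + 1]) := by
  refine orthogonalPaths_of_zigzag (k := k) (r := r) (b := 2) (c := 0) (e := 1) (v := r + k)
    (fun _ => r + 2) (fun _ => t + 1 - k)
    (by omega) (by omega) hr (by omega) ?_ ?_ (fun _ => Or.inl (by omega)) ?_ ?_ ?_ ?_ ?_ ?_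
  · intro ρ hρ; rw [Finset.mem_Icc] at hρ; omega
  · rw [Nat.card_Icc]; omega
  · intro i hi
    exact ⟨Or.inl (by omega), by omega⟩
  · intro i hi
    exact ⟨Or.inr (by omega), by omega⟩
  · intros; omega
  · intros; omega
  · intros; omega
  · intro ρ hρ
    rw [Finset.mem_Icc] at hρ
    by_cases h : ρ + 1 < r + k ∨ r + k + 1 ≤ ρ
    · exact Or.inr (Or.inr (zigCovers_left_two ht (by omega) hρ.1 (by omega) h))
    · by_cases h1 : ρ = r + k
      · exact Or.inr (Or.inl ⟨rfl, Or.inr (by omega)⟩)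
      · exact Or.inl ⟨0, by omega, Or.inl (by omega)⟩

theorem orthogonalPaths_even_odd_three {t k r : ℕ} (ht : t = 2 * r + 2 * k + 2)
    (hr : 1 ≤ r) (hk : 5 ≤ k) :
    OrthogonalPaths t ((Finset.Icc k (t - k)).image (fun j : ℕ => (j : ZMod t)))
      (List.replicate 3 1 ++ [2 * r - 1 + 1]) := by
  refine orthogonalPaths_of_zigzag (k := k) (r := r) (b := 2 * 1 + 1) (c := 1) (e := 1)
    (v := r + 3 + k - 2)
    (fun i => r + 3 + i)
    (fun i => t + 1 - k + if i = 0 then 3 else if i = 1 then 0 else 2)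
    (by omega) (by omega) hr (by omega) ?_ ?_ (fun _ => Or.inl (by omega)) ?_ ?_ ?_ ?_ ?_ ?_
  · intro ρ hρ; rw [Finset.mem_Icc] at hρ; omega
  · rw [Nat.card_Icc]; omega
  · intro i hi
    exact ⟨Or.inl (by omega), by omega⟩
  · intro i hi
    refine ⟨Or.inr ?_, ?_⟩ <;> split_ifs <;> omega
  · intros; omega
  · intro i hi j hj h
    split_ifs at h <;> omega
  · intro i hi j hj
    omega
  · intro ρ hρ
    rw [Finset.mem_Icc] at hρ
    by_cases h : ρ + 1 < r + k ∨ r + k + 2 * 1 + 1 < ρ ∨ ρ = r + k + 2 * 1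
    · exact Or.inr (Or.inr
        (zigCovers_left_odd_right_one ht (by omega) hr hρ.1 (by omega) h))
    · have : ρ + 1 = r + k ∨ ρ = r + k ∨ ρ = r + k + 1 ∨ ρ = r + k + 3 := by omega
      rcases this with h | h | h | h
      · exact Or.inl ⟨1, by omega, Or.inl (by simp; omega)⟩
      · exact Or.inl ⟨2, by omega, Or.inl (by simp; omega)⟩
      · exact Or.inr (Or.inl ⟨rfl, Or.inr (by omega)⟩)
      · exact Or.inl ⟨0, by omega, Or.inl (by simp; omega)⟩

/-- Injective enumeration of `{0, …, 2 * m - 2} ∪ {2 * m, 2 * m + 2}`. -/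
def skewIndex (m i : ℕ) : ℕ :=
  if i + 1 < 2 * m then i else if i + 1 = 2 * m then 2 * m else 2 * m + 2

/-- First coordinate of a matching realizing the differences `e - 1` for `e` in the range of
`skewIndex m`. -/
def skewFst (m l e : ℕ) : ℕ := if e % 2 = 0 then (2 * m + 2 - e) / 2 else (4 * m + 5 - e) / 2 + l

/-- Second coordinate of a matching realizing the differences `e - 1` for `e` in the range of
`skewIndex m`. -/
def skewSnd (m l e : ℕ) : ℕ := if e % 2 = 0 then (2 * m + e) / 2 else (4 * m + 3 + e) / 2 + l

section skew

variable {m l e f : ℕ}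

/-- The values taken by `skewIndex m`. -/
def InSkew (m e : ℕ) : Prop := e + 1 < 2 * m ∨ e = 2 * m ∨ e = 2 * m + 2

theorem inSkew_skewIndex (m i : ℕ) : InSkew m (skewIndex m i) := by
  unfold InSkew skewIndex
  split_ifs <;> omega

theorem skewIndex_injective {i j : ℕ} (hi : i < 2 * m + 1) (hj : j < 2 * m + 1)
    (h : skewIndex m i = skewIndex m j) : i = j := by
  unfold skewIndex at h
  split_ifs at h <;> omega

theorem exists_skewIndex_eq (hm : 1 ≤ m) (he : InSkew m e) :
    ∃ i < 2 * m + 1, skewIndex m i = e := by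
  unfold InSkew at he
  refine ⟨if e + 1 < 2 * m then e else if e = 2 * m then 2 * m - 1 else 2 * m, ?_, ?_⟩
  · split_ifs <;> omega
  · unfold skewIndex
    split_ifs <;> omega

theorem skewSnd_add_one (hm : 1 ≤ m) (he : InSkew m e) :
    skewSnd m l e + 1 = skewFst m l e + e := by
  unfold InSkew at he
  unfold skewSnd skewFst
  split_ifs <;> omega

theorem skewFst_bounds (hm : 2 ≤ m) (he : InSkew m e) :
    skewFst m l e ≤ 2 * m + 2 + l ∧ skewFst m l e ≠ m + 3 + l := by
  unfold InSkew at he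
  unfold skewFst
  split_ifs <;> omega

theorem skewSnd_le (hm : 2 ≤ m) (he : InSkew m e) : skewSnd m l e ≤ 3 * m + l := by
  unfold InSkew at he
  unfold skewSnd
  split_ifs <;> omega

theorem skewFst_injective (he : InSkew m e) (hf : InSkew m f)
    (h : skewFst m l e = skewFst m l f) : e = f := by
  unfold InSkew at he hf
  unfold skewFst at h
  split_ifs at h <;> omega

theorem skewSnd_injective (he : InSkew m e) (hf : InSkew m f)
    (h : skewSnd m l e = skewSnd m l f) : e = f := by
  unfold InSkew at he hf
  unfold skewSnd at h
  split_ifs at h <;> omega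

end skew

theorem orthogonalPaths_even_odd {t k r m : ℕ} (ht : t = 2 * r + 2 * k + 2 * m)
    (hr : 1 ≤ r) (hm : 2 ≤ m) (hk : 3 * m + 2 ≤ k) :
    OrthogonalPaths t ((Finset.Icc k (t - k)).image (fun j : ℕ => (j : ZMod t)))
      (List.replicate (2 * m + 1) 1 ++ [2 * r - 1 + 1]) := by
  obtain ⟨l, rfl⟩ := Nat.exists_eq_add_of_le hk
  set k := 3 * m + 2 + l with hkl
  refine orthogonalPaths_of_zigzag (k := k) (r := r) (b := 2 * m + 1) (c := 1) (e := 1)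
    (v := r + k + 2)
    (fun i => r + (2 * m + 1) + skewFst m l (skewIndex m i))
    (fun i => t + 1 - k + skewSnd m l (skewIndex m i))
    (by omega) (by omega) hr (by omega) ?_ ?_ (fun _ => Or.inl (by omega)) ?_ ?_ ?_ ?_ ?_ ?_
  · intro ρ hρ; rw [Finset.mem_Icc] at hρ; omega
  · rw [Nat.card_Icc]; omega
  · intro i hi
    have := skewFst_bounds (l := l) hm (inSkew_skewIndex m i)
    exact ⟨Or.inl (by omega), by omega⟩
  · intro i hi
    have := skewSnd_le (l := l) hm (inSkew_skewIndex m i)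
    exact ⟨Or.inr (by omega), by omega⟩
  · intro i hi j hj h
    exact skewIndex_injective hi hj
      (skewFst_injective (l := l) (inSkew_skewIndex m i) (inSkew_skewIndex m j) (by omega))
  · intro i hi j hj h
    exact skewIndex_injective hi hj
      (skewSnd_injective (l := l) (inSkew_skewIndex m i) (inSkew_skewIndex m j) (by omega))
  · intro i hi j hj
    have := skewFst_bounds (l := l) hm (inSkew_skewIndex m i)
    omega
  · intro ρ hρ
    rw [Finset.mem_Icc] at hρ
    by_cases h : ρ + 1 < r + k ∨ r + k + 2 * m + 1 < ρ ∨ ρ = r + k + 2 * m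
    · exact Or.inr (Or.inr
        (zigCovers_left_odd_right_one ht (by omega) hr hρ.1 (by omega) h))
    · by_cases h1 : ρ + 2 = r + k + 2 * m
      · exact Or.inr (Or.inl ⟨rfl, Or.inr (by omega)⟩)
      · have he : InSkew m (ρ + 1 - (r + k)) := by unfold InSkew; omega
        obtain ⟨i, hi, hie⟩ := exists_skewIndex_eq (by omega) he
        refine Or.inl ⟨i, hi, Or.inl ?_⟩
        have := skewSnd_add_one (l := l) (by omega) he
        rw [hie]
        omega

/-- The vertices after the first one of the path used when no isolated arcs are needed: a
zigzag with a unit step after an even number `c` of steps. -/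
def detourPath (h c j : ℕ) : ℕ :=
  if j ≤ c then (if j % 2 = 0 then j / 2 else h - j / 2)
  else if j % 2 = 1 then j / 2 + 1 else h - (j - 1) / 2

section detour

variable {h c q : ℕ}

theorem detourPath_even (hq : 2 * q ≤ c) : detourPath h c (2 * q) = q := by
  unfold detourPath
  split_ifs <;> omega

theorem detourPath_odd (hq : 2 * q + 1 ≤ c) : detourPath h c (2 * q + 1) = h - q := by
  unfold detourPath
  split_ifs <;> omega

theorem detourPath_odd_of_lt (hq : c < 2 * q + 1) : detourPath h c (2 * q + 1) = q + 1 := by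
  unfold detourPath
  split_ifs <;> omega

theorem detourPath_even_of_lt (hq : c < 2 * q + 2) : detourPath h c (2 * q + 2) = h - q := by
  unfold detourPath
  split_ifs <;> omega

end detour

theorem orthogonalPaths_zero {t k r : ℕ} (ht : t + 1 = 2 * r + 2 * k) (hr : 1 ≤ r)
    (hk : 2 ≤ k) :
    OrthogonalPaths t ((insert 1 (Finset.Icc k (t - k))).image (fun j : ℕ => (j : ZMod t)))
      (List.replicate 0 1 ++ [2 * r + 1]) := by
  refine orthogonalPaths_of_steps (fun _ => 0) (fun _ => 0)
    (fun i => if i = 0 then r + k - 1 else detourPath (t - k) (2 * (r / 2)) (i - 1))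
    ?_ ?_ (by omega) (by omega) ?_ (by omega) (by omega) ?_ (by omega) (by omega) (by omega) ?_
  · intro ρ hρ; rw [Finset.mem_insert, Finset.mem_Icc] at hρ; omega
  · rw [Finset.card_insert_of_notMem (by rw [Finset.mem_Icc]; omega), Nat.card_Icc]; omega
  · intro i hi
    unfold detourPath
    split_ifs <;> omega
  · intro i hi j hj h
    unfold detourPath at h
    split_ifs at h <;> omega
  · intro ρ hρ
    rw [Finset.mem_insert, Finset.mem_Icc] at hρ
    have key : (ρ = r + k ∨ ∃ j < 2 * r,
        StepMod t ρ (detourPath (t - k) (2 * (r / 2)) j)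
          (detourPath (t - k) (2 * (r / 2)) (j + 1))) := by
      rcases hρ with rfl | hρ
      · refine Or.inr ⟨2 * (r / 2), by omega, Or.inl ?_⟩
        rw [detourPath_even (by omega), detourPath_odd_of_lt (by omega)]
      by_cases h0 : ρ = r + k
      · exact Or.inl h0
      right
      by_cases hp : (ρ + k) % 2 = 0
      · by_cases h : ρ < r + k
        · obtain ⟨q, hq⟩ : ∃ q, ρ + 2 * q + 2 = 2 * r + k := ⟨(2 * r + k - ρ - 2) / 2, by omega⟩
          refine ⟨2 * q + 1, by omega, Or.inl ?_⟩
          rw [detourPath_odd_of_lt (by omega), detourPath_even_of_lt (by omega)]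
          omega
        · obtain ⟨q, hq⟩ : ∃ q, ρ = k + 2 * q + 2 := ⟨(ρ - k - 2) / 2, by omega⟩
          refine ⟨2 * q + 2, by omega, Or.inr ?_⟩
          rw [detourPath_even_of_lt (by omega), show 2 * q + 2 + 1 = 2 * (q + 1) + 1 by omega,
            detourPath_odd_of_lt (by omega)]
          omega
      · by_cases h : ρ < r + k
        · obtain ⟨q, hq⟩ : ∃ q, ρ = k + 2 * q + 1 := ⟨(ρ - k - 1) / 2, by omega⟩
          refine ⟨2 * q + 1, by omega, Or.inr ?_⟩
          rw [detourPath_odd (by omega), show 2 * q + 1 + 1 = 2 * (q + 1) by omega,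
            detourPath_even (by omega)]
          omega
        · obtain ⟨q, hq⟩ : ∃ q, ρ + 2 * q + 1 = 2 * r + k := ⟨(2 * r + k - ρ - 1) / 2, by omega⟩
          refine ⟨2 * q, by omega, Or.inl ?_⟩
          rw [detourPath_even (by omega), detourPath_odd (by omega)]
          omega
    rcases key with h | ⟨j, hj, h⟩
    · refine Or.inr ⟨0, by omega, Or.inr ?_⟩
      rw [if_pos rfl, if_neg (by omega), show 0 + 1 - 1 = 2 * 0 by omega,
        detourPath_even (by omega)]
      omega
    · refine Or.inr ⟨j + 1, by omega, ?_⟩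
      rwa [if_neg (by omega), if_neg (by omega), Nat.add_sub_cancel, Nat.add_sub_cancel]

theorem orthogonalPaths_zero_insert_empty {t k : ℕ} (ht : t + 1 = 2 * k) (hk : 2 ≤ k) :
    OrthogonalPaths t ((insert 1 (Finset.Icc k (t - k))).image (fun j : ℕ => (j : ZMod t)))
      (List.replicate 0 1 ++ [1]) := by
  have h0 : Finset.Icc k (t - k) = ∅ := Finset.Icc_eq_empty (by omega)
  rw [h0]
  refine orthogonalPaths_of_steps (fun _ => 0) (fun _ => 0) (fun i => i)
    ?_ ?_ (by omega) (by omega) ?_ (by omega) (by omega) ?_ (by omega) (by omega) (by omega) ?_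
  · intro ρ hρ; simp at hρ; omega
  · simp
  · intro i hi; omega
  · intro i hi j hj h; exact h
  · intro ρ hρ
    simp at hρ
    exact Or.inr ⟨0, by omega, Or.inl (by omega)⟩

/-- Lemma: under the stated conditions on a, s, t, the directed circulant Circ(t; S),
with S = {±(s+1)/2, …, ±⌊t/2⌋} for odd s and S = {1} ∪ {±(s/2+1), …, ±⌊t/2⌋} for even s,
admits an S-orthogonal (P₁^⟨a⟩, P_{t−s−a})-subdigraph. -/
theorem stmt16 (a s t : ℕ) (hs : 2 ≤ s) (hst : s < t)
    (h3 : Even t → s ≠ 3)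
    (ha1 : a ≤ s / 3) (ha2 : a ≤ 2 * (t / 2) - s) (hpar : a % 2 = s % 2)
    (S : Finset (ZMod t))
    (hS : S = if s % 2 = 1 then pmSet t ((s + 1) / 2) (t / 2)
              else insert (1 : ZMod t) (pmSet t (s / 2 + 1) (t / 2))) :
    OrthogonalPaths t S (List.replicate a 1 ++ [t - s - a]) := by
  subst hS
  by_cases hso : s % 2 = 1
  · rw [if_pos hso, pmSet_eq_image (by omega) (by omega)]
    obtain ⟨k, rfl⟩ : ∃ k, s = 2 * k - 1 := ⟨(s + 1) / 2, by omega⟩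
    obtain ⟨m, rfl⟩ : ∃ m, a = 2 * m + 1 := ⟨a / 2, by omega⟩
    rw [show (2 * k - 1 + 1) / 2 = k by omega]
    by_cases hto : t % 2 = 1
    · obtain ⟨r, hr⟩ : ∃ r, t + 1 = 2 * r + 2 * k + 2 * m :=
        ⟨(t + 1 - 2 * k - 2 * m) / 2, by omega⟩
      rw [show t - (2 * k - 1) - (2 * m + 1) = 2 * r - 1 by omega]
      exact orthogonalPaths_odd_odd hr (by omega) (by omega)
    · have h4 := h3 (Nat.even_iff.2 (by omega))
      obtain ⟨r, hr⟩ : ∃ r, t = 2 * r + 2 * k + 2 * m := ⟨(t - 2 * k - 2 * m) / 2, by omega⟩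
      by_cases hr0 : r = 0
      · rw [show t - (2 * k - 1) - (2 * m + 1) = 0 by omega]
        exact orthogonalPaths_even_odd_point (by omega) (by omega)
      rw [show t - (2 * k - 1) - (2 * m + 1) = 2 * r - 1 + 1 by omega]
      rcases (by omega : m = 0 ∨ m = 1 ∨ 2 ≤ m) with rfl | rfl | hm
      · exact orthogonalPaths_even_odd_one (by omega) (by omega) (by omega)
      · exact orthogonalPaths_even_odd_three (by omega) (by omega) (by omega)
      · exact orthogonalPaths_even_odd hr (by omega) hm (by omega)
  · rw [if_neg hso, pmSet_eq_image (by omega) (by omega), ← Nat.cast_one (R := ZMod t),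
      ← Finset.image_insert (fun j : ℕ => (j : ZMod t))]
    obtain ⟨k, rfl⟩ : ∃ k, s = 2 * k - 2 := ⟨s / 2 + 1, by omega⟩
    obtain ⟨m, rfl⟩ : ∃ m, a = 2 * m := ⟨a / 2, by omega⟩
    rw [show (2 * k - 2) / 2 + 1 = k by omega]
    by_cases hto : t % 2 = 1
    · rcases m with _ | m
      · by_cases hk : t + 1 = 2 * k
        · rw [show t - (2 * k - 2) - 2 * 0 = 1 by omega]
          exact orthogonalPaths_zero_insert_empty hk (by omega)
        · obtain ⟨r, hr⟩ : ∃ r, t + 1 = 2 * r + 2 * k := ⟨(t + 1 - 2 * k) / 2, by omega⟩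
          rw [show t - (2 * k - 2) - 2 * 0 = 2 * r + 1 by omega]
          exact orthogonalPaths_zero hr (by omega) (by omega)
      · obtain ⟨r, hr⟩ : ∃ r, t + 1 = 2 * r + 2 * k + 2 * m :=
          ⟨(t + 1 - 2 * k - 2 * m) / 2, by omega⟩
        rw [show t - (2 * k - 2) - 2 * (m + 1) = 2 * r - 1 by omega,
          show 2 * (m + 1) = 2 * m + 2 by omega]
        exact orthogonalPaths_odd_even hr (by omega) (by omega)
    · obtain ⟨r, hr⟩ : ∃ r, t + 2 = 2 * r + 2 * k + 2 * m :=
        ⟨(t + 2 - 2 * k - 2 * m) / 2, by omega⟩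
      by_cases hr0 : r = 0
      · rw [show t - (2 * k - 2) - 2 * m = 0 by omega]
        exact orthogonalPaths_even_even_point (by omega) (by omega) (by omega)
      · rw [show t - (2 * k - 2) - 2 * m = 2 * r - 1 + 1 by omega]
        exact orthogonalPaths_even_even hr (by omega) (by omega) (by omega)
end

section
/- Let t be an even integer. (a) If t ≥ 4, then OP*(3, t) has a solution. (b) If t ≥ 8, then OP*(2, 2, t) has a solution. -/
/-- A solution to the directed Oberwolfach problem OP*(m₁, …, m_k). -/
def HasOPSolution (m : List ℕ) : Prop :=
  ∃ σ : Fin (m.sum - 1) → Equiv.Perm (Fin m.sum),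
    (∀ i, (σ i).cycleType = (m : Multiset ℕ)) ∧
    ∀ x y : Fin m.sum, x ≠ y → ∃! i, σ i x = y

open Equiv Equiv.Perm

theorem cycleType_permCongr {α β : Type*} [Fintype α] [DecidableEq α] [Fintype β] [DecidableEq β]
    (e : α ≃ β) (σ : Perm α) : (e.permCongr σ).cycleType = σ.cycleType := by
  have h : e.permCongr σ =
      σ.extendDomain (p := fun _ : β => True)
        (e.trans (Equiv.subtypeUnivEquiv (by simp)).symm) := by
    ext x
    rw [extendDomain_apply_subtype _ _ trivial]
    rfl
  rw [h, cycleType_extendDomain]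

theorem cycleType_sumCongr {α β : Type*} [Fintype α] [DecidableEq α] [Fintype β] [DecidableEq β]
    (σ : Perm α) (τ : Perm β) :
    (Perm.sumCongr σ τ).cycleType = σ.cycleType + τ.cycleType := by
  have hl : Perm.sumCongr σ (1 : Perm β) =
      σ.extendDomain (Equiv.ofInjective (Sum.inl : α → α ⊕ β) Sum.inl_injective) := by
    ext x
    rcases x with a | b
    · exact (extendDomain_apply_image σ (Equiv.ofInjective _ Sum.inl_injective) a).symm
    · rw [extendDomain_apply_not_subtype _ _ (by simp)]
      rfl
  have hr : Perm.sumCongr (1 : Perm α) τ =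
      τ.extendDomain (Equiv.ofInjective (Sum.inr : β → α ⊕ β) Sum.inr_injective) := by
    ext x
    rcases x with a | b
    · rw [extendDomain_apply_not_subtype _ _ (by simp)]
      rfl
    · exact (extendDomain_apply_image τ (Equiv.ofInjective _ Sum.inr_injective) b).symm
  have hd : Perm.Disjoint (Perm.sumCongr σ (1 : Perm β)) (Perm.sumCongr (1 : Perm α) τ) := by
    rintro (a | b)
    · exact Or.inr rfl
    · exact Or.inl rfl
  have hm : Perm.sumCongr σ τ = Perm.sumCongr σ 1 * Perm.sumCongr 1 τ := by
    rw [sumCongr_mul, mul_one, one_mul]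
  rw [hm, hd.cycleType_mul, hl, hr, cycleType_extendDomain, cycleType_extendDomain]

/-- A permutation of `ZMod N ∪ {∞}` moving `∞` and realising every nonzero difference generates,
by translation, a solution to the directed Oberwolfach problem. -/
theorem hasOPSolution_of_starter {m : List ℕ} {N : ℕ} [NeZero N] (hm : m.sum = N + 1)
    (τ : Perm (Option (ZMod N))) (hτ : τ.cycleType = (m : Multiset ℕ)) (hinf : τ none ≠ none)
    (hdiff : ∀ d : ZMod N, d ≠ 0 → ∃ u, τ (some u) = some (u + d)) : HasOPSolution m := by
  let T : ZMod N → Perm (Option (ZMod N)) := fun g => optionCongr (Equiv.addRight g)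
  let π : ZMod N → Perm (Option (ZMod N)) := fun g => T g * τ * (T g)⁻¹
  have hπ : ∀ g v, π g (T g v) = T g (τ v) := fun g v => by simp [π]
  have hex : ∀ x y : Option (ZMod N), x ≠ y → ∃ g, π g x = y := by
    intro x y hxy
    rcases x with _ | a
    · rcases y with _ | b
      · exact absurd rfl hxy
      · obtain ⟨v, hv⟩ := Option.ne_none_iff_exists'.mp hinf
        refine ⟨b - v, ?_⟩
        have := hπ (b - v) none
        rw [hv] at this
        simpa [T] using this
    · rcases y with _ | b
      · have hne : τ.symm none ≠ none := fun h => hinf (by rw [← h, apply_symm_apply, h])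
        obtain ⟨u, hu⟩ := Option.ne_none_iff_exists'.mp hne
        refine ⟨a - u, ?_⟩
        have := hπ (a - u) (some u)
        rw [← hu, apply_symm_apply, hu] at this
        simpa [T] using this
      · obtain ⟨u, hu⟩ := hdiff (b - a) (fun h => hxy (by rw [sub_eq_zero.mp h]))
        refine ⟨a - u, ?_⟩
        have := hπ (a - u) (some u)
        rw [hu] at this
        have hb : u + (b - a) + (a - u) = b := by abel
        simpa [T, hb] using this
  have hinj : ∀ x, Function.Injective fun g => π g x := by
    intro x
    have hsub : ({x}ᶜ : Finset (Option (ZMod N))) ⊆ Finset.univ.image fun g => π g x := by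
      intro y hy
      obtain ⟨g, hg⟩ := hex x y (by simpa [eq_comm] using hy)
      exact Finset.mem_image.mpr ⟨g, Finset.mem_univ _, hg⟩
    have hc := Finset.card_le_card hsub
    rw [Finset.card_compl, Finset.card_singleton, Fintype.card_option, ZMod.card,
      Nat.add_sub_cancel] at hc
    have : Set.InjOn (fun g => π g x) ((Finset.univ : Finset (ZMod N)) : Set (ZMod N)) := by
      apply Finset.card_image_iff.mp
      apply le_antisymm Finset.card_image_le
      rwa [Finset.card_univ, ZMod.card]
    simpa using this
  have e : Option (ZMod N) ≃ Fin m.sum := Fintype.equivOfCardEq (by simp [ZMod.card, hm])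
  have f : Fin (m.sum - 1) ≃ ZMod N := Fintype.equivOfCardEq (by simp [ZMod.card, hm])
  refine ⟨fun i => e.permCongr (π (f i)), fun i => ?_, fun x y hxy => ?_⟩
  · rw [cycleType_permCongr, cycleType_conj, hτ]
  · obtain ⟨g, hg⟩ := hex (e.symm x) (e.symm y) (fun h => hxy (e.symm.injective h))
    refine ⟨f.symm g, by simp [hg], fun i hi => ?_⟩
    rw [Equiv.eq_symm_apply]
    apply hinj (e.symm x)
    change π (f i) (e.symm x) = π g (e.symm x)
    rw [hg, ← hi]
    simp

theorem finRotate_seq {α : Type*} {t : ℕ} (c : ℕ → α) (hc : c t = c 0) (i : Fin t) :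
    c (finRotate t i : Fin t) = c (i + 1) := by
  obtain _ | t := t
  · exact i.elim0
  · rw [coe_finRotate]
    split_ifs with h
    · rw [h, Fin.val_last, hc]
    · rfl

theorem natCast_add_eq {N a e b : ℕ} (h : b = a + e ∨ b + N = a + e) :
    (b : ZMod N) = (a : ZMod N) + (e : ZMod N) := by
  rcases h with h | h
  · rw [h, Nat.cast_add]
  · rw [← Nat.cast_add, ← h, Nat.cast_add, ZMod.natCast_self, add_zero]

/-- A `t`-cycle through all residues modulo `N = t + 2` except `x` and `y` and realising all
differences except `0` and `y - x` gives a starter for `OP*(3, t)`. -/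
theorem hasOPSolution_three {t N x y : ℕ} (ht : 2 ≤ t) (hN : N = t + 2) (c : ℕ → ℕ)
    (hc : c t = c 0) (hcov : ∀ v < N, v = x ∨ v = y ∨ ∃ i < t, c i = v)
    (hdiff : ∀ e, 0 < e → e < N →
      y = x + e ∨ ∃ i < t, c (i + 1) = c i + e ∨ c (i + 1) + N = c i + e) :
    HasOPSolution [3, t] := by
  have : NeZero N := ⟨by omega⟩
  let F : Fin 3 ⊕ Fin t → Option (ZMod N) :=
    Sum.elim ![none, some (x : ZMod N), some (y : ZMod N)] fun i => some (c i : ZMod N)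
  have hF : Function.Surjective F := by
    rintro (_ | v)
    · exact ⟨Sum.inl 0, rfl⟩
    · rw [← ZMod.natCast_zmod_val v]
      rcases hcov v.val (ZMod.val_lt v) with h | h | ⟨i, hi, h⟩
      · exact ⟨Sum.inl 1, by rw [h]; rfl⟩
      · exact ⟨Sum.inl 2, by rw [h]; rfl⟩
      · exact ⟨Sum.inr ⟨i, hi⟩, by rw [← h]; rfl⟩
  have hcard : Fintype.card (Fin 3 ⊕ Fin t) = Fintype.card (Option (ZMod N)) := by
    simp [ZMod.card]; omega
  let E := Equiv.ofBijective F ((Fintype.bijective_iff_surjective_and_card F).mpr ⟨hF, hcard⟩)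
  let τ := E.permCongr (Perm.sumCongr (finRotate 3) (finRotate t))
  have hτ : ∀ z, τ (F z) = F (Perm.sumCongr (finRotate 3) (finRotate t) z) := fun z => by
    change E (Perm.sumCongr (finRotate 3) (finRotate t) (E.symm (E z))) = _
    rw [Equiv.symm_apply_apply]
    rfl
  refine hasOPSolution_of_starter (N := N) (by simp; omega) τ ?_ ?_ ?_
  · rw [cycleType_permCongr, cycleType_sumCongr, cycleType_finRotate_of_le ht, cycleType_finRotate]
    rfl
  · have h : τ none = some (x : ZMod N) := hτ (Sum.inl 0)
    simp [h]
  · intro d hd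
    rw [← ZMod.natCast_zmod_val d]
    rcases hdiff d.val (ZMod.val_pos.mpr hd) (ZMod.val_lt d) with h | ⟨i, hi, h⟩
    · refine ⟨x, ?_⟩
      rw [← natCast_add_eq (Or.inl h)]
      exact hτ (Sum.inl 1)
    · refine ⟨c i, ?_⟩
      rw [← natCast_add_eq h, ← finRotate_seq c hc ⟨i, hi⟩]
      exact hτ (Sum.inr ⟨i, hi⟩)

/-- A `t`-cycle through all residues modulo `N = t + 3` except `x`, `p` and `p + 1` and realising
all differences except `0` and `±1` gives a starter for `OP*(2, 2, t)`. -/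
theorem hasOPSolution_two_two {t N x p : ℕ} (ht : 2 ≤ t) (hN : N = t + 3) (c : ℕ → ℕ)
    (hc : c t = c 0) (hcov : ∀ v < N, v = x ∨ v = p ∨ v = p + 1 ∨ ∃ i < t, c i = v)
    (hdiff : ∀ e, 1 < e → e + 1 < N →
      ∃ i < t, c (i + 1) = c i + e ∨ c (i + 1) + N = c i + e) :
    HasOPSolution [2, 2, t] := by
  have : NeZero N := ⟨by omega⟩
  let F : Fin 2 ⊕ (Fin 2 ⊕ Fin t) → Option (ZMod N) :=
    Sum.elim ![none, some (x : ZMod N)] (Sum.elim ![some (p : ZMod N), some ((p + 1 : ℕ) : ZMod N)]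
      fun i => some (c i : ZMod N))
  have hF : Function.Surjective F := by
    rintro (_ | v)
    · exact ⟨Sum.inl 0, rfl⟩
    · rw [← ZMod.natCast_zmod_val v]
      rcases hcov v.val (ZMod.val_lt v) with h | h | h | ⟨i, hi, h⟩
      · exact ⟨Sum.inl 1, by rw [h]; rfl⟩
      · exact ⟨Sum.inr (Sum.inl 0), by rw [h]; rfl⟩
      · exact ⟨Sum.inr (Sum.inl 1), by rw [h]; rfl⟩
      · exact ⟨Sum.inr (Sum.inr ⟨i, hi⟩), by rw [← h]; rfl⟩
  have hcard : Fintype.card (Fin 2 ⊕ (Fin 2 ⊕ Fin t)) = Fintype.card (Option (ZMod N)) := by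
    simp [ZMod.card]; omega
  let E := Equiv.ofBijective F ((Fintype.bijective_iff_surjective_and_card F).mpr ⟨hF, hcard⟩)
  let ρ := Perm.sumCongr (finRotate 2) (Perm.sumCongr (finRotate 2) (finRotate t))
  let τ := E.permCongr ρ
  have hτ : ∀ z, τ (F z) = F (ρ z) := fun z => by
    change E (ρ (E.symm (E z))) = _
    rw [Equiv.symm_apply_apply]
    rfl
  refine hasOPSolution_of_starter (N := N) (by simp; omega) τ ?_ ?_ ?_
  · rw [cycleType_permCongr, cycleType_sumCongr, cycleType_sumCongr, cycleType_finRotate_of_le ht,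
      cycleType_finRotate]
    rfl
  · have h : τ none = some (x : ZMod N) := hτ (Sum.inl 0)
    simp [h]
  · intro d hd
    rw [← ZMod.natCast_zmod_val d]
    have hpos := ZMod.val_pos.mpr hd
    have hlt := ZMod.val_lt d
    by_cases h1 : d.val = 1
    · refine ⟨p, ?_⟩
      rw [h1, ← natCast_add_eq (Or.inl rfl)]
      exact hτ (Sum.inr (Sum.inl 0))
    by_cases h2 : d.val + 1 = N
    · refine ⟨(p + 1 : ℕ), ?_⟩
      rw [← natCast_add_eq (b := p) (Or.inr (by omega))]
      exact hτ (Sum.inr (Sum.inl 1))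
    obtain ⟨i, hi, h⟩ := hdiff d.val (by omega) (by omega)
    refine ⟨c i, ?_⟩
    rw [← natCast_add_eq h, ← finRotate_seq c hc ⟨i, hi⟩]
    exact hτ (Sum.inr (Sum.inr ⟨i, hi⟩))

theorem hasOPSolution_three_four : HasOPSolution [3, 4] := by
  let F : Fin 3 ⊕ Fin 4 → Option (ZMod 6) :=
    Sum.elim ![some 0, some 1, some 3] ![none, some 5, some 4, some 2]
  have hF : Function.Bijective F := by decide
  let E := Equiv.ofBijective F hF
  let ρ := Perm.sumCongr (finRotate 3) (finRotate 4)
  let τ := E.permCongr ρ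
  have hτ : ∀ z, τ (F z) = F (ρ z) := fun z => by
    change E (ρ (E.symm (E z))) = _
    rw [Equiv.symm_apply_apply]
    rfl
  refine hasOPSolution_of_starter (m := [3, 4]) (N := 6) rfl τ ?_ ?_ ?_
  · rw [cycleType_permCongr, cycleType_sumCongr, cycleType_finRotate, cycleType_finRotate]
    rfl
  · have h : τ none = some 5 := hτ (Sum.inr 0)
    simp [h]
  · have key : ∀ d : ZMod 6, d ≠ 0 → ∃ z u, F z = some u ∧ F (ρ z) = some (u + d) := by decide
    intro d hd
    obtain ⟨z, u, hz, hu⟩ := key d hd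
    exact ⟨u, by rw [← hz, hτ, hu]⟩

set_option maxHeartbeats 1000000 in
theorem hasOPSolution_three_four_mul_sub_two {k : ℕ} (hk : 2 ≤ k) :
    HasOPSolution [3, 4 * k - 2] := by
  have hex : ∀ i, ∃ y : ℕ,
      (i = 0 ∧ y = 4 * k - 2) ∨
      (i = 1 ∧ y = 4 * k - 1) ∨
      (i = 2 ∧ y = 4 * k - 3) ∨
      (i = 3 ∧ y = 2 * k - 2) ∨
      (4 ≤ i ∧ i < 2 * k ∧ i % 2 = 0 ∧ y = i / 2 - 2) ∨
      (4 ≤ i ∧ i < 2 * k ∧ i % 2 = 1 ∧ y = 2 * k - 1 - i / 2) ∨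
      (i = 2 * k ∧ y = k - 1) ∨
      (i = 2 * k + 1 ∧ y = 3 * k - 3) ∨
      (2 * k + 2 ≤ i ∧ i < 4 * k - 2 ∧ i % 2 = 0 ∧ y = 2 * k - 2 + i / 2) ∨
      (2 * k + 2 ≤ i ∧ i < 4 * k - 2 ∧ i % 2 = 1 ∧ y = 4 * k - 3 - i / 2) ∨
      (4 * k - 2 ≤ i ∧ y = 4 * k - 2) := by
    intro i
    simp only [exists_or, exists_and_left, exists_eq, and_true]
    omega
  choose c hc using hex
  refine hasOPSolution_three (N := 4 * k) (x := k - 2) (y := 3 * k - 2) (by omega) (by omega) c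
    ?_ (fun v hv => ?_) (fun e he heN => ?_)
  · have h₀ := hc 0
    have h₁ := hc (4 * k - 2)
    omega
  · by_cases hx : v = k - 2
    · exact Or.inl hx
    by_cases hy : v = 3 * k - 2
    · exact Or.inr (Or.inl hy)
    refine Or.inr (Or.inr ?_)
    rcases (by omega : v < k - 2 ∨ v = k - 1 ∨ (k ≤ v ∧ v ≤ 2 * k - 3) ∨ v = 2 * k - 2 ∨
      (2 * k - 1 ≤ v ∧ v ≤ 3 * k - 4) ∨ v = 3 * k - 3 ∨ (3 * k - 1 ≤ v ∧ v ≤ 4 * k - 4) ∨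
      v = 4 * k - 3 ∨ v = 4 * k - 2 ∨ v = 4 * k - 1) with
      h | h | h | h | h | h | h | h | h | h <;>
    [obtain ⟨i, hi⟩ := exists_eq (a' := 4 + 2 * v); obtain ⟨i, hi⟩ := exists_eq (a' := 2 * k);
      obtain ⟨i, hi⟩ := exists_eq (a' := 4 * k - 1 - 2 * v); obtain ⟨i, hi⟩ := exists_eq (a' := 3);
      obtain ⟨i, hi⟩ := exists_eq (a' := 8 * k - 5 - 2 * v);
      obtain ⟨i, hi⟩ := exists_eq (a' := 2 * k + 1);
      obtain ⟨i, hi⟩ := exists_eq (a' := 2 * v + 4 - 4 * k); obtain ⟨i, hi⟩ := exists_eq (a' := 2);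
      obtain ⟨i, hi⟩ := exists_eq (a' := 0); obtain ⟨i, hi⟩ := exists_eq (a' := 1)] <;>
    (have h₀ := hc i; exact ⟨i, by omega, by omega⟩)
  · by_cases hy : e = 2 * k
    · left; omega
    right
    rcases (by omega : e = 1 ∨ e = 4 * k - 2 ∨ e = 2 * k + 1 ∨ e = 4 * k - 1 ∨ e = 2 * k - 2 ∨
      e = 2 * k - 1 ∨ (e % 2 = 0 ∧ e = 2 ∧ 3 ≤ k) ∨ (e % 2 = 0 ∧ e = 2 * k + 2 ∧ 3 ≤ k) ∨
      (e % 2 = 1 ∧ 3 ≤ e ∧ e ≤ 2 * k - 3) ∨ (e % 2 = 0 ∧ 2 * k + 4 ≤ e ∧ e ≤ 4 * k - 4) ∨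
      (e % 2 = 1 ∧ 2 * k + 3 ≤ e ∧ e ≤ 4 * k - 3) ∨ (e % 2 = 0 ∧ 4 ≤ e ∧ e ≤ 2 * k - 4)) with
      h | h | h | h | h | h | h | h | h | h | h | h <;>
    [obtain ⟨i, hi⟩ := exists_eq (a' := 0); obtain ⟨i, hi⟩ := exists_eq (a' := 1);
      obtain ⟨i, hi⟩ := exists_eq (a' := 2); obtain ⟨i, hi⟩ := exists_eq (a' := 2 * k - 1);
      obtain ⟨i, hi⟩ := exists_eq (a' := 2 * k); obtain ⟨i, hi⟩ := exists_eq (a' := 4 * k - 3);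
      obtain ⟨i, hi⟩ := exists_eq (a' := 2 * k + 1); obtain ⟨i, hi⟩ := exists_eq (a' := 3);
      obtain ⟨i, hi⟩ := exists_eq (a' := 2 * k + 1 - e);
      obtain ⟨i, hi⟩ := exists_eq (a' := e + 1 - 2 * k);
      obtain ⟨i, hi⟩ := exists_eq (a' := 6 * k - 1 - e);
      obtain ⟨i, hi⟩ := exists_eq (a' := 2 * k - 1 + e)] <;>
    (have h₀ := hc i; have h₁ := hc (i + 1); exact ⟨i, by omega, by omega⟩)

set_option maxHeartbeats 1000000 in
theorem hasOPSolution_three_four_mul {k : ℕ} (hk : 2 ≤ k) : HasOPSolution [3, 4 * k] := by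
  have hex : ∀ i, ∃ y : ℕ,
      (i = 0 ∧ y = 4 * k) ∨
      (i = 1 ∧ y = 4 * k + 1) ∨
      (i = 2 ∧ y = 4 * k - 1) ∨
      (i = 3 ∧ y = 2 * k - 1) ∨
      (4 ≤ i ∧ i < 2 * k + 2 ∧ i % 2 = 0 ∧ y = i / 2 - 2) ∨
      (4 ≤ i ∧ i < 2 * k + 2 ∧ i % 2 = 1 ∧ y = 2 * k - i / 2) ∨
      (i = 2 * k + 2 ∧ y = 3 * k - 1) ∨
      (i = 2 * k + 3 ∧ y = 3 * k - 2) ∨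
      (2 * k + 4 ≤ i ∧ i < 4 * k ∧ i % 2 = 0 ∧ y = 2 * k - 1 + i / 2) ∨
      (2 * k + 4 ≤ i ∧ i < 4 * k ∧ i % 2 = 1 ∧ y = 4 * k - 1 - i / 2) ∨
      (4 * k ≤ i ∧ y = 4 * k) := by
    intro i
    simp only [exists_or, exists_and_left, exists_eq, and_true]
    omega
  choose c hc using hex
  refine hasOPSolution_three (N := 4 * k + 2) (x := k - 1) (y := 3 * k) (by omega) (by omega) c
    ?_ (fun v hv => ?_) (fun e he heN => ?_)
  · have h₀ := hc 0
    have h₁ := hc (4 * k)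
    omega
  · by_cases hx : v = k - 1
    · exact Or.inl hx
    by_cases hy : v = 3 * k
    · exact Or.inr (Or.inl hy)
    refine Or.inr (Or.inr ?_)
    rcases (by omega : v < k - 1 ∨ (k ≤ v ∧ v ≤ 2 * k - 2) ∨ v = 2 * k - 1 ∨
      (2 * k ≤ v ∧ v ≤ 3 * k - 3) ∨ v = 3 * k - 2 ∨ v = 3 * k - 1 ∨
      (3 * k + 1 ≤ v ∧ v ≤ 4 * k - 2) ∨ v = 4 * k - 1 ∨ v = 4 * k ∨ v = 4 * k + 1) with
      h | h | h | h | h | h | h | h | h | h <;>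
    [obtain ⟨i, hi⟩ := exists_eq (a' := 4 + 2 * v);
      obtain ⟨i, hi⟩ := exists_eq (a' := 4 * k + 1 - 2 * v); obtain ⟨i, hi⟩ := exists_eq (a' := 3);
      obtain ⟨i, hi⟩ := exists_eq (a' := 8 * k - 1 - 2 * v);
      obtain ⟨i, hi⟩ := exists_eq (a' := 2 * k + 3); obtain ⟨i, hi⟩ := exists_eq (a' := 2 * k + 2);
      obtain ⟨i, hi⟩ := exists_eq (a' := 2 * v + 2 - 4 * k); obtain ⟨i, hi⟩ := exists_eq (a' := 2);
      obtain ⟨i, hi⟩ := exists_eq (a' := 0); obtain ⟨i, hi⟩ := exists_eq (a' := 1)] <;>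
    (have h₀ := hc i; exact ⟨i, by omega, by omega⟩)
  · by_cases hy : e = 2 * k + 1
    · left; omega
    right
    rcases (by omega : e = 1 ∨ e = 4 * k ∨ e = 2 * k + 2 ∨ e = 2 * k + 3 ∨ e = 2 * k - 1 ∨
      e = 4 * k + 1 ∨ e = 2 * k ∨ (e = 3 ∧ 3 ≤ k) ∨ (e % 2 = 0 ∧ 2 ≤ e ∧ e ≤ 2 * k - 2) ∨
      (e % 2 = 1 ∧ 2 * k + 5 ≤ e ∧ e ≤ 4 * k - 1) ∨ (e % 2 = 0 ∧ 2 * k + 4 ≤ e ∧ e ≤ 4 * k - 2) ∨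
      (e % 2 = 1 ∧ 5 ≤ e ∧ e ≤ 2 * k - 3)) with
      h | h | h | h | h | h | h | h | h | h | h | h <;>
    [obtain ⟨i, hi⟩ := exists_eq (a' := 0); obtain ⟨i, hi⟩ := exists_eq (a' := 1);
      obtain ⟨i, hi⟩ := exists_eq (a' := 2); obtain ⟨i, hi⟩ := exists_eq (a' := 3);
      obtain ⟨i, hi⟩ := exists_eq (a' := 2 * k + 1); obtain ⟨i, hi⟩ := exists_eq (a' := 2 * k + 2);
      obtain ⟨i, hi⟩ := exists_eq (a' := 4 * k - 1); obtain ⟨i, hi⟩ := exists_eq (a' := 2 * k + 3);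
      obtain ⟨i, hi⟩ := exists_eq (a' := 2 * k + 2 - e);
      obtain ⟨i, hi⟩ := exists_eq (a' := e - 2 * k);
      obtain ⟨i, hi⟩ := exists_eq (a' := 6 * k + 2 - e);
      obtain ⟨i, hi⟩ := exists_eq (a' := 2 * k + e)] <;>
    (have h₀ := hc i; have h₁ := hc (i + 1); exact ⟨i, by omega, by omega⟩)

set_option maxHeartbeats 1000000 in
theorem hasOPSolution_two_two_four_mul_sub_two {k : ℕ} (hk : 2 ≤ k) :
    HasOPSolution [2, 2, 4 * k - 2] := by
  have hex : ∀ i, ∃ y : ℕ,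
      (i < 2 * k - 1 ∧ i % 2 = 0 ∧ y = i / 2) ∨
      (i < 2 * k - 1 ∧ i % 2 = 1 ∧ y = 2 * k - 1 - i / 2) ∨
      (i = 2 * k - 1 ∧ y = 3 * k - 1) ∨
      (i = 2 * k ∧ y = k) ∨
      (2 * k + 1 ≤ i ∧ i < 4 * k - 2 ∧ i % 2 = 1 ∧ y = 4 * k - 2 - i / 2) ∨
      (2 * k + 1 ≤ i ∧ i < 4 * k - 2 ∧ i % 2 = 0 ∧ y = 2 * k - 1 + i / 2) ∨
      (4 * k - 2 ≤ i ∧ y = 0) := by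
    intro i
    simp only [exists_or, exists_and_left, exists_eq, and_true]
    omega
  choose c hc using hex
  refine hasOPSolution_two_two (N := 4 * k + 1) (x := 4 * k - 2) (p := 4 * k - 1)
    (by omega) (by omega) c ?_ (fun v hv => ?_) (fun e he heN => ?_)
  · have h₀ := hc 0
    have h₁ := hc (4 * k - 2)
    omega
  · by_cases hx : 4 * k - 2 ≤ v
    · omega
    refine Or.inr (Or.inr (Or.inr ?_))
    rcases (by omega : v < k ∨ v = k ∨ (k < v ∧ v < 2 * k) ∨ (2 * k ≤ v ∧ v ≤ 3 * k - 2) ∨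
      v = 3 * k - 1 ∨ (3 * k ≤ v ∧ v ≤ 4 * k - 3)) with
      h | h | h | h | h | h <;>
    [obtain ⟨i, hi⟩ := exists_eq (a' := 2 * v); obtain ⟨i, hi⟩ := exists_eq (a' := 2 * k);
      obtain ⟨i, hi⟩ := exists_eq (a' := 4 * k - 1 - 2 * v);
      obtain ⟨i, hi⟩ := exists_eq (a' := 8 * k - 3 - 2 * v);
      obtain ⟨i, hi⟩ := exists_eq (a' := 2 * k - 1);
      obtain ⟨i, hi⟩ := exists_eq (a' := 2 * v + 2 - 4 * k)] <;>
    (have h₀ := hc i; exact ⟨i, by omega, by omega⟩)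
  · rcases (by omega : e = 2 * k ∨ e = 2 * k + 2 ∨ e = 2 * k - 2 ∨ e = 2 * k + 1 ∨
    (e % 2 = 1 ∧ 3 ≤ e ∧ e ≤ 2 * k - 1) ∨ (e % 2 = 1 ∧ 2 * k + 3 ≤ e ∧ e ≤ 4 * k - 1) ∨
    (e % 2 = 0 ∧ 2 ≤ e ∧ e ≤ 2 * k - 4) ∨ (e % 2 = 0 ∧ 2 * k + 4 ≤ e ∧ e ≤ 4 * k - 2)) with
      h | h | h | h | h | h | h | h <;>
    [obtain ⟨i, hi⟩ := exists_eq (a' := 2 * k - 2); obtain ⟨i, hi⟩ := exists_eq (a' := 2 * k - 1);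
      obtain ⟨i, hi⟩ := exists_eq (a' := 2 * k); obtain ⟨i, hi⟩ := exists_eq (a' := 4 * k - 3);
      obtain ⟨i, hi⟩ := exists_eq (a' := 2 * k - 1 - e);
      obtain ⟨i, hi⟩ := exists_eq (a' := e - 2 * k - 2);
      obtain ⟨i, hi⟩ := exists_eq (a' := 2 * k - 1 + e);
      obtain ⟨i, hi⟩ := exists_eq (a' := 6 * k - e)] <;>
    (have h₀ := hc i; have h₁ := hc (i + 1); exact ⟨i, by omega, by omega⟩)

set_option maxHeartbeats 1000000 in
theorem hasOPSolution_two_two_four_mul {k : ℕ} (hk : 2 ≤ k) : HasOPSolution [2, 2, 4 * k] := by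
  have hex : ∀ i, ∃ y : ℕ,
      (i < 2 * k ∧ i % 2 = 0 ∧ y = i / 2) ∨
      (i < 2 * k ∧ i % 2 = 1 ∧ y = 2 * k - i / 2) ∨
      (i = 2 * k ∧ y = 3 * k) ∨
      (i = 2 * k + 1 ∧ y = k) ∨
      (2 * k + 2 ≤ i ∧ i < 4 * k ∧ i % 2 = 0 ∧ y = 2 * k + i / 2) ∨
      (2 * k + 2 ≤ i ∧ i < 4 * k ∧ i % 2 = 1 ∧ y = 4 * k - i / 2) ∨
      (4 * k ≤ i ∧ y = 0) := by
    intro i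
    simp only [exists_or, exists_and_left, exists_eq, and_true]
    omega
  choose c hc using hex
  refine hasOPSolution_two_two (N := 4 * k + 3) (x := 4 * k) (p := 4 * k + 1)
    (by omega) (by omega) c ?_ (fun v hv => ?_) (fun e he heN => ?_)
  · have h₀ := hc 0
    have h₁ := hc (4 * k)
    omega
  · by_cases hx : 4 * k ≤ v
    · omega
    refine Or.inr (Or.inr (Or.inr ?_))
    rcases (by omega : v < k ∨ v = k ∨ (k < v ∧ v ≤ 2 * k) ∨ (2 * k < v ∧ v ≤ 3 * k - 1) ∨
      v = 3 * k ∨ (3 * k < v ∧ v ≤ 4 * k - 1)) with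
      h | h | h | h | h | h <;>
    [obtain ⟨i, hi⟩ := exists_eq (a' := 2 * v); obtain ⟨i, hi⟩ := exists_eq (a' := 2 * k + 1);
      obtain ⟨i, hi⟩ := exists_eq (a' := 4 * k + 1 - 2 * v);
      obtain ⟨i, hi⟩ := exists_eq (a' := 8 * k + 1 - 2 * v);
      obtain ⟨i, hi⟩ := exists_eq (a' := 2 * k);
      obtain ⟨i, hi⟩ := exists_eq (a' := 2 * v - 4 * k)] <;>
    (have h₀ := hc i; exact ⟨i, by omega, by omega⟩)
  · rcases (by omega : e = 2 * k - 1 ∨ e = 2 * k + 3 ∨ e = 2 * k + 1 ∨ e = 2 * k + 2 ∨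
    (e % 2 = 0 ∧ 2 ≤ e ∧ e ≤ 2 * k) ∨ (e % 2 = 0 ∧ 2 * k + 4 ≤ e ∧ e ≤ 4 * k) ∨
    (e % 2 = 1 ∧ 2 * k + 5 ≤ e ∧ e ≤ 4 * k + 1) ∨ (e % 2 = 1 ∧ 3 ≤ e ∧ e ≤ 2 * k - 3)) with
      h | h | h | h | h | h | h | h <;>
    [obtain ⟨i, hi⟩ := exists_eq (a' := 2 * k - 1); obtain ⟨i, hi⟩ := exists_eq (a' := 2 * k);
      obtain ⟨i, hi⟩ := exists_eq (a' := 2 * k + 1); obtain ⟨i, hi⟩ := exists_eq (a' := 4 * k - 1);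
      obtain ⟨i, hi⟩ := exists_eq (a' := 2 * k - e);
      obtain ⟨i, hi⟩ := exists_eq (a' := e - 2 * k - 3);
      obtain ⟨i, hi⟩ := exists_eq (a' := 6 * k + 3 - e);
      obtain ⟨i, hi⟩ := exists_eq (a' := 2 * k + e)] <;>
    (have h₀ := hc i; have h₁ := hc (i + 1); exact ⟨i, by omega, by omega⟩)

theorem stmt17 (t : ℕ) (hte : Even t) :
    (4 ≤ t → HasOPSolution [3, t]) ∧ (8 ≤ t → HasOPSolution [2, 2, t]) := by
  obtain ⟨k, rfl | rfl⟩ : ∃ k, t = 4 * k ∨ t = 4 * k - 2 := by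
    obtain ⟨r, rfl⟩ := hte
    exact ⟨(r + 1) / 2, by omega⟩
  · refine ⟨fun h => ?_, fun h => hasOPSolution_two_two_four_mul (by omega)⟩
    obtain rfl | hk : k = 1 ∨ 2 ≤ k := by omega
    · exact hasOPSolution_three_four
    · exact hasOPSolution_three_four_mul hk
  · exact ⟨fun h => hasOPSolution_three_four_mul_sub_two (by omega),
      fun h => hasOPSolution_two_two_four_mul_sub_two (by omega)⟩
end
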